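/- Let F be an algebraically closed field and g₁, g₂ ∈ Sp₄(F) elements of order 3 generating an absolutely irreducible subgroup. Then the character field of ⟨g₁, g₂⟩ (the subfield of F generated by traces of all elements of ⟨g₁,g₂⟩) is generated by the three elements tr(g₁g₂), χ₂(g₁g₂), and tr(g₁g₂⁻¹). -/

import Mathlib

namespace SpFour
open Matrix

abbrev M2 (F : Type*) := Matrix (Fin 2) (Fin 2) F
abbrev M4 (F : Type*) := Matrix (Fin 2 ⊕ Fin 2) (Fin 2 ⊕ Fin 2) F

variable {F : Type*} [Field F]

/-- Absolute irreducibility. -/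
def Irr (x y : M4 F) : Prop := Algebra.adjoin F {x, y} = ⊤

/-- The property to be proved for a pair, relative to a subfield. -/
def Good (K : Subfield F) (x y : M4 F) : Prop :=
  trace (x * y) ∈ K → trace (x * y ^ 2) ∈ K →
  ((x * y).charpoly.coeff 2 ∈ K ∨ trace (x * y * (x ^ 2 * y ^ 2)) ∈ K) →
  (x * y).charpoly.coeff 2 ∈ K ∧
    ∀ m ∈ Submonoid.closure ({x, y} : Set (M4 F)), trace m ∈ K

lemma irr_mem {x y : M4 F} (h : Irr x y) (m : M4 F) : m ∈ Algebra.adjoin F {x, y} := by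
  rw [h]; trivial

lemma irr_conj {x y Q Qi : M4 F} (h : Irr x y) (hQ : Qi * Q = 1) :
    Irr (Qi * x * Q) (Qi * y * Q) := by
  have hQ' : Q * Qi = 1 := mul_eq_one_comm.mp hQ
  have key : ∀ m ∈ Algebra.adjoin F {x, y},
      Qi * m * Q ∈ Algebra.adjoin F {Qi * x * Q, Qi * y * Q} := by
    intro m hm
    induction hm using Algebra.adjoin_induction with
    | mem z hz =>
      rcases hz with rfl | rfl
      · exact Algebra.subset_adjoin (by simp)
      · exact Algebra.subset_adjoin (by simp)
    | algebraMap r =>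
      have : Qi * algebraMap F (M4 F) r * Q = algebraMap F (M4 F) r := by
        rw [← Algebra.commutes, mul_assoc, hQ, mul_one]
      rw [this]; exact Subalgebra.algebraMap_mem _ _
    | add a b _ _ ha hb =>
      rw [mul_add, add_mul]; exact Subalgebra.add_mem _ ha hb
    | mul a b _ _ ha hb =>
      have : Qi * (a * b) * Q = (Qi * a * Q) * (Qi * b * Q) := by
        calc Qi * (a * b) * Q = Qi * a * 1 * b * Q := by noncomm_ring
          _ = _ := by rw [← hQ']; noncomm_ring
      rw [this]; exact Subalgebra.mul_mem _ ha hb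
  unfold Irr
  rw [eq_top_iff]
  intro m _
  have := key (Q * m * Qi) (irr_mem h _)
  have e : Qi * (Q * m * Qi) * Q = m := by
    calc Qi * (Q * m * Qi) * Q = (Qi * Q) * m * (Qi * Q) := by noncomm_ring
      _ = m := by rw [hQ]; simp
  rwa [e] at this

lemma good_conj {K : Subfield F} {x y Q Qi : M4 F} (hQ : Qi * Q = 1)
    (h : Good K (Qi * x * Q) (Qi * y * Q)) : Good K x y := by
  have hQ' : Q * Qi = 1 := mul_eq_one_comm.mp hQ
  have hm : ∀ a b : M4 F, (Qi * a * Q) * (Qi * b * Q) = Qi * (a * b) * Q := by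
    intro a b
    calc (Qi * a * Q) * (Qi * b * Q) = Qi * a * (Q * Qi) * b * Q := by noncomm_ring
      _ = _ := by rw [hQ']; noncomm_ring
  have ht : ∀ a : M4 F, trace (Qi * a * Q) = trace a := by
    intro a
    rw [trace_mul_comm, ← mul_assoc, hQ', one_mul]
  have hc : ∀ a : M4 F, (Qi * a * Q).charpoly = a.charpoly := by
    intro a
    rw [mul_assoc, charpoly_mul_comm, mul_assoc, hQ', mul_one]
  intro h1 h2 h3
  unfold Good at h
  simp only [pow_two, hm, ht, hc] at h
  simp only [pow_two] at h2 h3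
  obtain ⟨h4, h5⟩ := h h1 h2 h3
  refine ⟨h4, fun m hmm => ?_⟩
  rw [← ht]
  apply h5
  induction hmm using Submonoid.closure_induction with
  | mem z hz =>
    rcases hz with rfl | rfl
    · exact Submonoid.subset_closure (by simp)
    · exact Submonoid.subset_closure (by simp)
  | one => simp [hQ]
  | mul a b _ _ ha hb =>
    rw [← hm]; exact Submonoid.mul_mem _ ha hb

lemma irr_inv {x y : M4 F} (h : Irr x y) (p : Submodule F (Fin 2 ⊕ Fin 2 → F))
    (hx : ∀ v ∈ p, x *ᵥ v ∈ p) (hy : ∀ v ∈ p, y *ᵥ v ∈ p)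
    {v : Fin 2 ⊕ Fin 2 → F} (hv : v ∈ p) (hv0 : v ≠ 0) (w : Fin 2 ⊕ Fin 2 → F) : w ∈ p := by
  have key : ∀ m ∈ Algebra.adjoin F {x, y}, ∀ v ∈ p, m *ᵥ v ∈ p := by
    intro m hm
    induction hm using Algebra.adjoin_induction with
    | mem z hz =>
      rcases hz with rfl | rfl
      · exact hx
      · exact hy
    | algebraMap r =>
      intro v hv
      rw [Algebra.algebraMap_eq_smul_one, smul_mulVec, one_mulVec]
      exact p.smul_mem _ hv
    | add a b _ _ ha hb =>
      intro v hv
      rw [add_mulVec]; exact p.add_mem (ha v hv) (hb v hv)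
    | mul a b _ _ ha hb =>
      intro v hv
      rw [← mulVec_mulVec]; exact ha _ (hb v hv)
  obtain ⟨i, hi⟩ := Function.ne_iff.mp hv0
  have e : vecMulVec w (Pi.single i (v i)⁻¹) *ᵥ v = w := by
    rw [vecMulVec_mulVec]
    have : (Pi.single i (v i)⁻¹ : Fin 2 ⊕ Fin 2 → F) ⬝ᵥ v = 1 := by
      rw [single_dotProduct, inv_mul_cancel₀ hi]
    rw [this]; simp
  rw [← e]
  exact key _ (irr_mem h _) v hv

lemma irr_comm {x y : M4 F} (h : Irr x y) (z : M4 F) (hx : x * z = z * x) (hy : y * z = z * y) :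
    ∃ c : F, z = c • 1 := by
  have key : ∀ m : M4 F, m * z = z * m := by
    intro m
    have hm := irr_mem h m
    induction hm using Algebra.adjoin_induction with
    | mem z hz =>
      rcases hz with rfl | rfl
      · exact hx
      · exact hy
    | algebraMap r => exact Algebra.commutes _ _
    | add a b _ _ ha hb => rw [add_mul, mul_add, ha, hb]
    | mul a b _ _ ha hb => rw [mul_assoc, hb, ← mul_assoc, ha, mul_assoc]
  have := Matrix.mem_range_scalar_of_commute_single (M := z) (fun i j _ => key _)
  obtain ⟨c, hc⟩ := this
  refine ⟨c, ?_⟩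
  rw [← hc]; ext i j; simp [Matrix.scalar_apply, Matrix.diagonal_apply, Matrix.one_apply]

/-- Two elements killed by `T² + T + 1` never generate an irreducible algebra. -/
lemma not_irr_quad {x y : M4 F} (h : Irr x y) (hx : x ^ 2 + x + 1 = 0) (hy : y ^ 2 + y + 1 = 0) :
    False := by
  have hx2 : x * x = -1 - x := by
    calc x * x = (x ^ 2 + x + 1) - 1 - x := by noncomm_ring
      _ = _ := by rw [hx]; abel
  have hy2 : y * y = -1 - y := by
    calc y * y = (y ^ 2 + y + 1) - 1 - y := by noncomm_ring
      _ = _ := by rw [hy]; abel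
  obtain ⟨c, hc⟩ := irr_comm h (x * y + y * x + y + x) (by
      have e1 : x * (x * y + y * x + y + x) = (x * x) * y + x * y * x + x * y + x * x := by
        noncomm_ring
      have e2 : (x * y + y * x + y + x) * x = x * y * x + y * (x * x) + y * x + x * x := by
        noncomm_ring
      rw [e1, e2, hx2]; noncomm_ring) (by
      have e1 : y * (x * y + y * x + y + x) = y * x * y + (y * y) * x + y * y + y * x := by
        noncomm_ring
      have e2 : (x * y + y * x + y + x) * y = x * (y * y) + y * x * y + y * y + x * y := by
        noncomm_ring
      rw [e1, e2, hy2]; noncomm_ring)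
  have hyx : y * x = c • 1 - x * y - y - x := by
    rw [← hc]; abel
  let s : Finset (M4 F) := by classical exact {1, x, y, x * y}
  let p := Submodule.span F (s : Set (M4 F))
  have m1 : (1 : M4 F) ∈ p := Submodule.subset_span (by simp [s])
  have mx : x ∈ p := Submodule.subset_span (by simp [s])
  have my : y ∈ p := Submodule.subset_span (by simp [s])
  have mxy : x * y ∈ p := Submodule.subset_span (by simp [s])
  have lx : ∀ m ∈ p, x * m ∈ p := by
    intro m hm
    induction hm using Submodule.span_induction with
    | mem z hz =>
      simp only [s, Finset.coe_insert, Finset.coe_singleton, Set.mem_insert_iff,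
        Set.mem_singleton_iff] at hz
      rcases hz with rfl | rfl | rfl | rfl
      · simpa using mx
      · rw [hx2]; exact p.sub_mem (p.neg_mem m1) mx
      · exact mxy
      · rw [← mul_assoc, hx2]
        have : (-1 - x) * y = - y - x * y := by noncomm_ring
        rw [this]; exact p.sub_mem (p.neg_mem my) mxy
    | zero => simp
    | add a b _ _ ha hb => rw [mul_add]; exact p.add_mem ha hb
    | smul r a _ ha => rw [mul_smul_comm]; exact p.smul_mem _ ha
  have ly : ∀ m ∈ p, y * m ∈ p := by
    intro m hm
    induction hm using Submodule.span_induction with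
    | mem z hz =>
      simp only [s, Finset.coe_insert, Finset.coe_singleton, Set.mem_insert_iff,
        Set.mem_singleton_iff] at hz
      rcases hz with rfl | rfl | rfl | rfl
      · simpa using my
      · rw [hyx]; exact p.sub_mem (p.sub_mem (p.sub_mem (p.smul_mem _ m1) mxy) my) mx
      · rw [hy2]; exact p.sub_mem (p.neg_mem m1) my
      · rw [← mul_assoc, hyx]
        have : (c • 1 - x * y - y - x) * y = c • y - x * (y * y) - y * y - x * y := by
          simp only [sub_mul, smul_mul_assoc, one_mul, mul_assoc]
        rw [this, hy2]
        have : c • y - x * (-1 - y) - (-1 - y) - x * y = c • y + x + 1 + y := by noncomm_ring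
        rw [this]
        exact p.add_mem (p.add_mem (p.add_mem (p.smul_mem _ my) mx) m1) my
    | zero => simp
    | add a b _ _ ha hb => rw [mul_add]; exact p.add_mem ha hb
    | smul r a _ ha => rw [mul_smul_comm]; exact p.smul_mem _ ha
  have key : ∀ m ∈ Algebra.adjoin F {x, y}, ∀ n ∈ p, m * n ∈ p := by
    intro m hm
    induction hm using Algebra.adjoin_induction with
    | mem z hz =>
      rcases hz with rfl | rfl
      · exact lx
      · exact ly
    | algebraMap r =>
      intro v hv
      rw [Algebra.algebraMap_eq_smul_one, smul_mul_assoc, one_mul]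
      exact p.smul_mem _ hv
    | add a b _ _ ha hb =>
      intro v hv
      rw [add_mul]; exact p.add_mem (ha v hv) (hb v hv)
    | mul a b _ _ ha hb =>
      intro v hv
      rw [mul_assoc]; exact ha _ (hb v hv)
  have top : p = ⊤ := by
    rw [eq_top_iff]; intro m _
    simpa using key m (irr_mem h m) 1 m1
  have h1 : Module.finrank F p ≤ s.card := finrank_span_finset_le_card s
  have h2 : s.card ≤ 4 := by
    classical
    simp only [s]; exact Finset.card_le_four
  rw [top, finrank_top, Module.finrank_matrix] at h1
  simp at h1
  omega

end SpFour

namespace SpFour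
open Matrix
variable {F : Type*} [Field F]

/-- Second characteristic coefficient of a block matrix. -/
lemma chi2_blocks (a b c d : M2 F) :
    (fromBlocks a b c d).charpoly.coeff 2 =
      a.det + d.det + trace a * trace d - trace (b * c) := by
  have e : (fromBlocks a b c d).charpoly = 
      Polynomial.X ^ 4 + Polynomial.C (-(trace a + trace d)) * Polynomial.X ^ 3
      + Polynomial.C (a.det + d.det + trace a * trace d - trace (b * c)) * Polynomial.X ^ 2
      + Polynomial.C (-(trace a * d.det + trace d * a.det - trace (b * c) * (trace a + trace d)
          + trace (a * b * c) + trace (b * d * c))) * Polynomial.X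
      + Polynomial.C ((fromBlocks a b c d).det) := by
    rw [← charpoly_reindex finSumFinEquiv, ← det_reindex_self finSumFinEquiv (fromBlocks a b c d)]
    have h : (reindex finSumFinEquiv finSumFinEquiv (fromBlocks a b c d) : Matrix (Fin 4) (Fin 4) F)
        = !![a 0 0, a 0 1, b 0 0, b 0 1; a 1 0, a 1 1, b 1 0, b 1 1;
             c 0 0, c 0 1, d 0 0, d 0 1; c 1 0, c 1 1, d 1 0, d 1 1] := by
      ext i j; fin_cases i <;> fin_cases j <;> rfl
    have h' := h
    change reindex (finSumFinEquiv : Fin 2 ⊕ Fin 2 ≃ Fin (2+2)) finSumFinEquiv (fromBlocks a b c d) = _ at h'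
    rw [h']
    simp only [charpoly, charmatrix, det_succ_row_zero, Fin.sum_univ_succ, trace_fin_two, det_fin_two, mul_apply]
    simp [Fin.succAbove, Fin.sum_univ_succ]
    ring
  rw [e]
  simp only [Polynomial.coeff_add, Polynomial.coeff_C_mul, Polynomial.coeff_X_pow, Polynomial.coeff_X, Polynomial.coeff_C]
  simp

end SpFour

namespace SpFour
open Matrix
variable {F : Type*} [Field F]

lemma tr_blocks (a b c d : M2 F) : Matrix.trace (fromBlocks a b c d) = Matrix.trace a + Matrix.trace d := by
  simp [Matrix.trace, Fintype.sum_sum_type]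

lemma cayley2 (w : M2 F) : w * w = Matrix.trace w • w - w.det • 1 := by
  ext i j
  fin_cases i <;> fin_cases j <;>
    simp [mul_apply, Fin.sum_univ_two, trace_fin_two, det_fin_two] <;> ring

/-- The `K`-span of `1, u, w, u w`. -/
def InR (K : Subfield F) (u w : M2 F) (m : M2 F) : Prop :=
  ∃ a ∈ K, ∃ b ∈ K, ∃ c ∈ K, ∃ d ∈ K, m = a • 1 + b • u + c • w + d • (u * w)

/-- Rationality of the invariants of a pair of `2 × 2` matrices. -/
structure Rat2 (K : Subfield F) (u w : M2 F) : Prop where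
  tu : trace u ∈ K
  du : u.det ∈ K
  tw : trace w ∈ K
  dw : w.det ∈ K
  tuw : trace (u * w) ∈ K

lemma InR.add {K : Subfield F} {u w m n : M2 F} (hm : InR K u w m) (hn : InR K u w n) :
    InR K u w (m + n) := by
  obtain ⟨a, ha, b, hb, c, hc, d, hd, rfl⟩ := hm
  obtain ⟨a', ha', b', hb', c', hc', d', hd', rfl⟩ := hn
  refine ⟨a + a', add_mem ha ha', b + b', add_mem hb hb', c + c', add_mem hc hc',
    d + d', add_mem hd hd', ?_⟩
  module

lemma InR.smul {K : Subfield F} {u w m : M2 F} (hm : InR K u w m) {r : F} (hr : r ∈ K) :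
    InR K u w (r • m) := by
  obtain ⟨a, ha, b, hb, c, hc, d, hd, rfl⟩ := hm
  refine ⟨r * a, mul_mem hr ha, r * b, mul_mem hr hb, r * c, mul_mem hr hc,
    r * d, mul_mem hr hd, ?_⟩
  module

lemma InR.one {K : Subfield F} {u w : M2 F} : InR K u w 1 :=
  ⟨1, one_mem K, 0, zero_mem K, 0, zero_mem K, 0, zero_mem K, by module⟩

lemma InR.zero {K : Subfield F} {u w : M2 F} : InR K u w 0 :=
  ⟨0, zero_mem K, 0, zero_mem K, 0, zero_mem K, 0, zero_mem K, by module⟩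

lemma InR.u {K : Subfield F} {u w : M2 F} : InR K u w u :=
  ⟨0, zero_mem K, 1, one_mem K, 0, zero_mem K, 0, zero_mem K, by module⟩

lemma InR.w {K : Subfield F} {u w : M2 F} : InR K u w w :=
  ⟨0, zero_mem K, 0, zero_mem K, 1, one_mem K, 0, zero_mem K, by module⟩

lemma InR.umul {K : Subfield F} {u w m : M2 F} (h : Rat2 K u w) (hm : InR K u w m) :
    InR K u w (u * m) := by
  obtain ⟨a, ha, b, hb, c, hc, d, hd, rfl⟩ := hm
  obtain ⟨h1, h2, h3, h4, h5⟩ := h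
  refine ⟨-(b * u.det), neg_mem (mul_mem hb h2), a + b * trace u, add_mem ha (mul_mem hb h1),
    -(d * u.det), neg_mem (mul_mem hd h2), c + d * trace u, add_mem hc (mul_mem hd h1), ?_⟩
  ext i j
  fin_cases i <;> fin_cases j <;>
    simp [mul_apply, Fin.sum_univ_two, trace_fin_two, det_fin_two] <;> ring

lemma InR.wmul {K : Subfield F} {u w m : M2 F} (h : Rat2 K u w) (hm : InR K u w m) :
    InR K u w (w * m) := by
  obtain ⟨a, ha, b, hb, c, hc, d, hd, rfl⟩ := hm
  obtain ⟨h1, h2, h3, h4, h5⟩ := h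
  have h6 : trace (u * w) - trace u * trace w ∈ K := sub_mem h5 (mul_mem h1 h3)
  refine ⟨b * (trace (u * w) - trace u * trace w) - c * w.det - d * trace u * w.det,
    sub_mem (sub_mem (mul_mem hb h6) (mul_mem hc h4)) (mul_mem (mul_mem hd h1) h4),
    b * trace w + d * w.det, add_mem (mul_mem hb h3) (mul_mem hd h4),
    a + b * trace u + c * trace w + d * trace (u * w), 
    add_mem (add_mem (add_mem ha (mul_mem hb h1)) (mul_mem hc h3)) (mul_mem hd h5),
    -b, neg_mem hb, ?_⟩
  ext i j
  fin_cases i <;> fin_cases j <;>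
    simp [mul_apply, Fin.sum_univ_two, trace_fin_two, det_fin_two] <;> ring

lemma InR.mul {K : Subfield F} {u w m n : M2 F} (h : Rat2 K u w) (hm : InR K u w m)
    (hn : InR K u w n) : InR K u w (m * n) := by
  obtain ⟨a, ha, b, hb, c, hc, d, hd, rfl⟩ := hm
  have := (((hn.smul ha).add ((hn.umul h).smul hb)).add ((hn.wmul h).smul hc)).add
    (((hn.wmul h).umul h).smul hd)
  convert this using 1
  simp only [add_mul, smul_mul_assoc, one_mul, mul_assoc]

lemma InR.trace {K : Subfield F} {u w m : M2 F} (h : Rat2 K u w) (hm : InR K u w m) :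
    trace m ∈ K := by
  obtain ⟨a, ha, b, hb, c, hc, d, hd, rfl⟩ := hm
  obtain ⟨h1, h2, h3, h4, h5⟩ := h
  simp only [trace_add, trace_smul, trace_one, smul_eq_mul]
  exact add_mem (add_mem (add_mem (mul_mem ha (natCast_mem K _)) (mul_mem hb h1)) (mul_mem hc h3))
    (mul_mem hd h5)

lemma InR.det {K : Subfield F} {u w m : M2 F} (h : Rat2 K u w) (hm : InR K u w m) :
    m.det ∈ K := by
  obtain ⟨a, ha, b, hb, c, hc, d, hd, rfl⟩ := hm
  obtain ⟨h1, h2, h3, h4, h5⟩ := h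
  have e : (a • 1 + b • u + c • w + d • (u * w)).det =
      a * a + a * b * u.trace + a * c * w.trace + a * d * (u * w).trace + b * b * u.det
      + b * c * (u.trace * w.trace - (u * w).trace) + b * d * (u.det * w.trace) + c * c * w.det
      + c * d * (w.det * u.trace) + d * d * (u.det * w.det) := by
    simp [mul_apply, Fin.sum_univ_two, trace_fin_two, det_fin_two]; ring
  rw [e]
  have := @K.mul_mem
  have := @K.add_mem
  have := @K.sub_mem
  repeat' first | assumption | apply add_mem | apply sub_mem | apply mul_mem

/-- Block matrices over the quaternion-like ring `K⟨u, w⟩` have rational traces. -/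
lemma blocks_rat {K : Subfield F} {u w : M2 F} (h : Rat2 K u w)
    {a b c d a' b' c' d' : M2 F}
    (ha : InR K u w a) (hb : InR K u w b) (hc : InR K u w c) (hd : InR K u w d)
    (ha' : InR K u w a') (hb' : InR K u w b') (hc' : InR K u w c') (hd' : InR K u w d') :
    (fromBlocks a b c d * fromBlocks a' b' c' d').charpoly.coeff 2 ∈ K ∧
    ∀ m ∈ Submonoid.closure ({fromBlocks a b c d, fromBlocks a' b' c' d'} : Set (M4 F)),
      Matrix.trace m ∈ K := by
  constructor
  · rw [fromBlocks_multiply, chi2_blocks]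
    have k1 := (ha.mul h ha').add (hb.mul h hc')
    have k2 := (ha.mul h hb').add (hb.mul h hd')
    have k3 := (hc.mul h ha').add (hd.mul h hc')
    have k4 := (hc.mul h hb').add (hd.mul h hd')
    exact sub_mem (add_mem (add_mem (k1.det h) (k4.det h)) (mul_mem (k1.trace h) (k4.trace h)))
      ((k2.mul h k3).trace h)
  · have key : ∀ m ∈ Submonoid.closure ({fromBlocks a b c d, fromBlocks a' b' c' d'} : Set (M4 F)),
        ∃ p q r s, InR K u w p ∧ InR K u w q ∧ InR K u w r ∧ InR K u w s ∧
          m = fromBlocks p q r s := by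
      intro m hm
      induction hm using Submonoid.closure_induction with
      | mem z hz =>
        rcases hz with rfl | rfl
        · exact ⟨a, b, c, d, ha, hb, hc, hd, rfl⟩
        · exact ⟨a', b', c', d', ha', hb', hc', hd', rfl⟩
      | one => exact ⟨1, 0, 0, 1, InR.one, InR.zero, InR.zero, InR.one, fromBlocks_one.symm⟩
      | mul x y _ _ hx hy =>
        obtain ⟨p, q, r, s, hp, hq, hr, hs, rfl⟩ := hx
        obtain ⟨p', q', r', s', hp', hq', hr', hs', rfl⟩ := hy
        rw [fromBlocks_multiply]
        exact ⟨_, _, _, _, (hp.mul h hp').add (hq.mul h hr'), (hp.mul h hq').add (hq.mul h hs'),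
          (hr.mul h hp').add (hs.mul h hr'), (hr.mul h hq').add (hs.mul h hs'), rfl⟩
    intro m hm
    obtain ⟨p, q, r, s, hp, hq, hr, hs, rfl⟩ := key m hm
    rw [tr_blocks]
    exact add_mem (hp.trace h) (hs.trace h)

lemma comm_tr {u A : M2 F} {β : F} (tu : trace u = -1) (du : u.det = 1)
    (tA : trace A = -1) (dA : A.det = 1 - β) :
    trace (u * (-1 - A) * ((-1 - u) * A)) = β + trace (u * A) * (trace (u * A) - 1) := by
  have tu' : u 1 1 = -1 - u 0 0 := by rw [trace_fin_two] at tu; linear_combination tu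
  have tA' : A 1 1 = -1 - A 0 0 := by rw [trace_fin_two] at tA; linear_combination tA
  rw [det_fin_two, tu'] at du
  rw [det_fin_two, tA'] at dA
  simp [trace_fin_two, mul_apply, Fin.sum_univ_two, tu', tA']
  linear_combination (1 - 2 * (A 0 0 * (-1 - A 0 0) - A 0 1 * A 1 0)) * du - dA

/-- Final form, type (1,2). -/
lemma good_a {K : Subfield F} (h3 : (3 : F) ≠ 0) {u A : M2 F} {β : F} (tu : trace u = -1)
    (du : u.det = 1)
    (tA : trace A = -1) (dA : A.det = 1 - β) :
    Good K (fromBlocks 1 0 0 u) (fromBlocks A 1 (-β • 1) (-1 - A)) := by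
  intro h1 _ h4
  have k3 : (3 : F) ∈ K := ofNat_mem K 3
  have t1 : trace (u * A) ∈ K := by
    have e : trace (fromBlocks 1 0 0 u * fromBlocks A 1 (-β • 1) (-1 - A)) = - trace (u * A) := by
      rw [fromBlocks_multiply, tr_blocks]
      simp [mul_sub, tA, tu]; ring
    rw [e] at h1
    simpa using h1
  have hβ : β ∈ K := by
    suffices h : 3 * β ∈ K by
      have := mul_mem (inv_mem k3) h
      rwa [inv_mul_cancel_left₀ h3] at this
    rcases h4 with h4 | h4
    · rw [fromBlocks_multiply, chi2_blocks] at h4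
      have e : 3 * β = 1 + trace (u * A) - ((1 * A + 0 * (-β • 1)).det + (0 * 1 + u * (-1 - A)).det +
         (1 * A + 0 * (-β • 1)).trace * (0 * 1 + u * (-1 - A)).trace -
         ((1 * 1 + 0 * (-1 - A)) * (0 * A + u * (-β • 1))).trace) := by
        have d1 : (-1 - A : M2 F).det = 1 + trace A + A.det := by
          simp [det_fin_two, trace_fin_two]; ring
        have d2 : (0 * 1 + u * (-1 - A) : M2 F).det = 1 - β := by
          rw [zero_mul, zero_add, det_mul, du, d1, tA, dA]; ring
        rw [d2]
        simp [tu, tA, dA, mul_sub]; ring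
      rw [e]
      exact sub_mem (add_mem (one_mem K) t1) h4
    · have u2 : u * u = -1 - u := by rw [cayley2, tu, du]; module
      have A2 : A * A = (β - 1) • 1 - A := by rw [cayley2, tA, dA]; module
      have hx2 : (fromBlocks 1 0 0 u : M4 F) ^ 2 = fromBlocks 1 0 0 (-1 - u) := by
        rw [pow_two, fromBlocks_multiply, ← u2]; simp
      have hy2 : (fromBlocks A 1 (-β • 1) (-1 - A) : M4 F) ^ 2 =
          fromBlocks (-1 - A) (-1) (β • 1) A := by
        rw [pow_two, fromBlocks_multiply]
        have q1 : A * A + 1 * (-β • 1) = -1 - A := by rw [A2, one_mul]; module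
        have q2 : A * 1 + 1 * (-1 - A) = -1 := by noncomm_ring
        have q3 : (-β • 1) * A + (-1 - A) * (-β • 1) = β • (1 : M2 F) := by
          simp only [smul_mul_assoc, one_mul, mul_smul_comm, mul_one]; module
        have q4 : (-β • 1) * 1 + (-1 - A) * (-1 - A) = A := by
          have : (-1 - A) * (-1 - A) = 1 + A + A + A * A := by noncomm_ring
          rw [this, A2, mul_one]; module
        rw [q1, q2, q3, q4]
      have hcm := comm_tr tu du tA dA
      have e : 3 * β = 2 + trace (u * A) * (trace (u * A) - 1)
         - trace (fromBlocks 1 0 0 u * fromBlocks A 1 (-β • 1) (-1 - A)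
          * (fromBlocks 1 0 0 u ^ 2 * fromBlocks A 1 (-β • 1) (-1 - A) ^ 2)) := by
        rw [hx2, hy2]
        simp only [fromBlocks_multiply, tr_blocks]
        have r1 : (1 * A + 0 * (-β • 1)) * (1 * (-1 - A) + 0 * (β • 1)) +
            (1 * 1 + 0 * (-1 - A)) * (0 * (-1 - A) + (-1 - u) * (β • 1)) = 
            -A - A * A + β • (-1 - u) := by
          simp only [one_mul, zero_mul, add_zero, zero_add, mul_smul_comm, mul_one]
          simp only [smul_zero, add_zero]; rw [mul_sub]; simp
        have r2 : (0 * A + u * (-β • 1)) * (1 * -1 + 0 * A) + (0 * 1 + u * (-1 - A)) *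
            (0 * -1 + (-1 - u) * A) = β • u + u * (-1 - A) * ((-1 - u) * A) := by
          simp
        rw [r1, r2, A2, trace_add, trace_add, hcm]
        simp [tu, tA]; ring
      rw [e]
      exact sub_mem (add_mem (ofNat_mem K 2) (mul_mem t1 (sub_mem t1 (one_mem K)))) h4
  have hr : Rat2 K u A := ⟨by rw [tu]; exact neg_mem (one_mem K), by rw [du]; exact one_mem K,
    by rw [tA]; exact neg_mem (one_mem K), by rw [dA]; exact sub_mem (one_mem K) hβ, t1⟩
  have n1 : InR K u A (-1 - A) := by
    have := (InR.one (K := K) (u := u) (w := A)).smul (neg_mem (one_mem K))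
    have := this.add ((InR.w (K := K) (u := u) (w := A)).smul (neg_mem (one_mem K)))
    convert this using 1
    module
  exact blocks_rat hr InR.one InR.zero InR.zero InR.u InR.w InR.one (InR.one.smul (neg_mem hβ)) n1

/-- Final form, generic case of type (1,1). -/
lemma good_b {K : Subfield F} (h3 : (3 : F) ≠ 0) {u w : M2 F} {τ : F} (hτ : τ ≠ 0)
    (tu : trace u = -1) (du : u.det = 1) (tw : trace w = -1) (dw : w.det = 1) 
    (hw : w * w = -1 - w) :
    Good K (fromBlocks 1 0 0 u)
      (fromBlocks (1 + (1 - τ) • (w - 1)) (w - 1) ((τ * (1 - τ)) • (w - 1)) (1 + τ • (w - 1))) := by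
  intro h1 h2 _
  have e1 : trace (fromBlocks 1 0 0 u * fromBlocks (1 + (1 - τ) • (w - 1)) (w - 1)
      ((τ * (1 - τ)) • (w - 1)) (1 + τ • (w - 1))) = 4 * τ - 2 + τ * trace (u * w) := by
    rw [fromBlocks_multiply, tr_blocks]
    simp [mul_add, mul_sub, tu, tw]; ring
  have e2 : trace (fromBlocks 1 0 0 u * fromBlocks (1 + (1 - τ) • (w - 1)) (w - 1)
      ((τ * (1 - τ)) • (w - 1)) (1 + τ • (w - 1)) ^ 2) = 5 * τ - 2 - τ * trace (u * w) := by
    have hb : (w - 1) * (w - 1) = - (3 : F) • w := by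
      have : (w - 1) * (w - 1) = w * w - w - w + 1 := by noncomm_ring
      rw [this, hw]; module
    rw [pow_two, fromBlocks_multiply, fromBlocks_multiply, tr_blocks]
    have q1 : (1 + (1 - τ) • (w - 1)) * (1 + (1 - τ) • (w - 1)) +
        (w - 1) * ((τ * (1 - τ)) • (w - 1)) = 1 + (1 - τ) • (-w - (2 : F) • 1) := by
      simp only [mul_add, add_mul, mul_one, one_mul, smul_mul_assoc, mul_smul_comm, hb]
      module
    have q2 : (τ * (1 - τ)) • (w - 1) * (w - 1) + (1 + τ • (w - 1)) * (1 + τ • (w - 1)) =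
        1 + τ • (-w - (2 : F) • 1) := by
      simp only [mul_add, add_mul, mul_one, one_mul, smul_mul_assoc, mul_smul_comm, hb]
      module
    rw [q1, q2]
    simp [mul_add, mul_sub, tu, tw]; ring
  have k9 : 9 * τ ∈ K := by
    rw [e1] at h1; rw [e2] at h2
    have : 9 * τ = (4 * τ - 2 + τ * trace (u * w)) + (5 * τ - 2 - τ * trace (u * w)) + 4 := by ring
    rw [this]; exact add_mem (add_mem h1 h2) (ofNat_mem K 4)
  have kτ : τ ∈ K := by
    have h9 : (9 : F) ≠ 0 := by
      have : (9 : F) = 3 * 3 := by norm_num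
      rw [this]; exact mul_ne_zero h3 h3
    have := mul_mem (inv_mem (ofNat_mem K 9)) k9
    rwa [inv_mul_cancel_left₀ h9] at this
  have t1 : trace (u * w) ∈ K := by
    rw [e1] at h1
    have : trace (u * w) = τ⁻¹ * ((4 * τ - 2 + τ * trace (u * w)) - 4 * τ + 2) := by
      field_simp; ring
    rw [this]
    exact mul_mem (inv_mem kτ) (add_mem (sub_mem h1 (mul_mem (ofNat_mem K 4) kτ)) (ofNat_mem K 2))
  have hr : Rat2 K u w := ⟨by rw [tu]; exact neg_mem (one_mem K), by rw [du]; exact one_mem K,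
    by rw [tw]; exact neg_mem (one_mem K), by rw [dw]; exact one_mem K, t1⟩
  have n1 : InR K u w (w - 1) := by
    have := (InR.one (K := K) (u := u) (w := w)).smul (neg_mem (one_mem K))
    have := this.add (InR.w (K := K) (u := u) (w := w))
    convert this using 1
    module
  have k1 : 1 - τ ∈ K := sub_mem (one_mem K) kτ
  exact blocks_rat hr InR.one InR.zero InR.zero InR.u (InR.one.add (n1.smul k1)) n1
    (n1.smul (mul_mem kτ k1)) (InR.one.add (n1.smul kτ))

/-- Final form, degenerate case of type (1,1). -/
lemma good_c {K : Subfield F} {l m : F} :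
    Good K (fromBlocks !![0, -1; 1, -1] (l • !![0, -1; 0, 1]) 0 1)
      (fromBlocks 1 0 (m • !![0, -1; 0, 1]) !![0, -1; 1, -1]) := by
  intro h1 _ _
  have hlm : l * m ∈ K := by
    rw [fromBlocks_multiply, tr_blocks] at h1
    simp [trace_fin_two, mul_apply, Fin.sum_univ_two] at h1
    have := add_mem h1 (ofNat_mem K 2)
    ring_nf at this
    exact this
  constructor
  · rw [fromBlocks_multiply, chi2_blocks]
    have : 3 + 2 * (l * m) ∈ K := add_mem (ofNat_mem K 3) (mul_mem (ofNat_mem K 2) hlm)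
    convert this using 1
    simp [trace_fin_two, det_fin_two, mul_apply, Fin.sum_univ_two]; ring
  · have key : ∀ x ∈ Submonoid.closure ({fromBlocks !![0, -1; 1, -1] (l • !![0, -1; 0, 1]) 0 1,
        fromBlocks 1 0 (m • !![0, -1; 0, 1]) !![0, -1; 1, -1]} : Set (M4 F)),
        ∃ p q r s : M2 F, (∀ i j, p i j ∈ K) ∧ (∀ i j, q i j ∈ K) ∧ (∀ i j, r i j ∈ K) ∧ 
          (∀ i j, s i j ∈ K) ∧ x = fromBlocks p (l • q) (m • r) s := by
      have c0 : (0 : F) ∈ K := zero_mem K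
      have c1 : (1 : F) ∈ K := one_mem K
      have c2 : (-1 : F) ∈ K := neg_mem (one_mem K)
      have hz : ∀ i j, (0 : M2 F) i j ∈ K := fun i j => c0
      have ho : ∀ i j, (1 : M2 F) i j ∈ K := by
        intro i j; fin_cases i <;> fin_cases j <;> simp [c0, c1]
      have hX : ∀ i j, (!![0, -1; 1, -1] : M2 F) i j ∈ K := by
        intro i j; fin_cases i <;> fin_cases j <;> simp [c0, c1, c2]
      have hY : ∀ i j, (!![0, -1; 0, 1] : M2 F) i j ∈ K := by
        intro i j; fin_cases i <;> fin_cases j <;> simp [c0, c1, c2]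
      have hmul : ∀ a b : M2 F, (∀ i j, a i j ∈ K) → (∀ i j, b i j ∈ K) → ∀ i j, (a * b) i j ∈ K := by
        intro a b ha hb i j
        rw [mul_apply]; exact sum_mem fun k _ => mul_mem (ha _ _) (hb _ _)
      intro x hx
      induction hx using Submonoid.closure_induction with
      | mem z hz' =>
        rcases hz' with rfl | rfl
        · exact ⟨_, _, 0, 1, hX, hY, hz, ho, by simp⟩
        · exact ⟨1, 0, _, _, ho, hz, hY, hX, by simp⟩
      | one => exact ⟨1, 0, 0, 1, ho, hz, hz, ho, by simp⟩
      | mul x y _ _ hx hy =>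
        obtain ⟨p, q, r, s, hp, hq, hr, hs, rfl⟩ := hx
        obtain ⟨p', q', r', s', hp', hq', hr', hs', rfl⟩ := hy
        refine ⟨p * p' + (l * m) • (q * r'), p * q' + q * s', r * p' + s * r',
          (l * m) • (r * q') + s * s', ?_, ?_, ?_, ?_, ?_⟩
        · exact fun i j => add_mem (hmul _ _ hp hp' i j) (mul_mem hlm (hmul _ _ hq hr' i j))
        · exact fun i j => add_mem (hmul _ _ hp hq' i j) (hmul _ _ hq hs' i j)
        · exact fun i j => add_mem (hmul _ _ hr hp' i j) (hmul _ _ hs hr' i j)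
        · exact fun i j => add_mem (mul_mem hlm (hmul _ _ hr hq' i j)) (hmul _ _ hs hs' i j)
        · rw [fromBlocks_multiply]
          congr 1 <;> simp only [smul_mul_assoc, mul_smul_comm, smul_add, smul_smul, mul_comm]
    intro x hx
    obtain ⟨p, q, r, s, hp, hq, hr, hs, rfl⟩ := key x hx
    rw [tr_blocks, trace_fin_two, trace_fin_two]
    exact add_mem (add_mem (hp _ _) (hp _ _)) (add_mem (hs _ _) (hs _ _))

end SpFour

namespace SpFour
open Matrix
variable {F : Type*} [Field F]

/-- The adjugate of a `2 × 2` matrix. -/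
def bar (A : M2 F) : M2 F := trace A • 1 - A

lemma mul_bar (A : M2 F) : A * bar A = A.det • 1 := by
  rw [bar, mul_sub, cayley2]; simp

lemma bar_mul (A : M2 F) : bar A * A = A.det • 1 := by
  rw [bar, sub_mul, cayley2]; simp

lemma bar_bar (A : M2 F) : bar (bar A) = A := by
  simp only [bar, trace_sub, trace_smul, trace_one]
  simp
  module

lemma bar_inj {A B : M2 F} (h : bar A = bar B) : A = B := by
  rw [← bar_bar A, h, bar_bar]

lemma bar_add (A B : M2 F) : bar (A + B) = bar A + bar B := by
  simp only [bar, trace_add]; module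

lemma bar_smul (r : F) (A : M2 F) : bar (r • A) = r • bar A := by
  simp only [bar, trace_smul, smul_eq_mul]; module

lemma irr_no_fix {u : M2 F} (tu : trace u = -1) (du : u.det = 1) (h3 : (3 : F) ≠ 0) {y : M4 F}
    (h : Irr (fromBlocks 1 0 0 u) y) (v : Fin 2 ⊕ Fin 2 → F) 
    (hx : fromBlocks 1 0 0 u *ᵥ v = v) (hy : y *ᵥ v = v) : v = 0 := by
  by_contra hv
  let p : Submodule F (Fin 2 ⊕ Fin 2 → F) := Submodule.span F {v}
  have hp : ∀ z ∈ p, fromBlocks 1 0 0 u *ᵥ z = z := by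
    intro z hz
    obtain ⟨c, rfl⟩ := Submodule.mem_span_singleton.mp hz
    rw [mulVec_smul, hx]
  have key : ∀ w, w ∈ p := by
    refine fun w => irr_inv h p ?_ ?_ (Submodule.mem_span_singleton_self v) hv w
    · intro z hz; rwa [hp z hz]
    · intro z hz
      obtain ⟨c, rfl⟩ := Submodule.mem_span_singleton.mp hz
      rwa [mulVec_smul, hy]
  have h1 : (fromBlocks 1 0 0 u : M4 F) = 1 := by
    apply Matrix.ext_of_mulVec_single
    intro i
    rw [hp _ (key _), one_mulVec]
  rw [← fromBlocks_one, fromBlocks_inj] at h1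
  obtain ⟨-, -, -, rfl⟩ := h1
  rw [trace_one] at tu
  simp at tu
  apply h3; linear_combination tu

/-- Type (1,2). -/
lemma good_blocks_a {K : Subfield F} (h3 : (3 : F) ≠ 0) {u A B C D : M2 F} (tu : trace u = -1)
    (du : u.det = 1) (hirr : Irr (fromBlocks 1 0 0 u) (fromBlocks A B C D))
    (hy2 : (fromBlocks A B C D) ^ 2 = fromBlocks (bar A) (bar C) (bar B) (bar D))
    (hq : (fromBlocks A B C D) ^ 2 + (fromBlocks A B C D) + 1 = 0) 
    (hy3 : (fromBlocks A B C D) ^ 3 = 1) :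
    Good K (fromBlocks 1 0 0 u) (fromBlocks A B C D) := by
  rw [hy2, ← fromBlocks_one, fromBlocks_add, fromBlocks_add, ← fromBlocks_zero, fromBlocks_inj] at hq
  rw [pow_succ', hy2, fromBlocks_multiply, ← fromBlocks_one, fromBlocks_inj] at hy3
  obtain ⟨q1, q2, q3, q4⟩ := hq
  obtain ⟨r1, r2, r3, r4⟩ := hy3
  have bA : bar A = -1 - A := by
    calc bar A = (bar A + A + 1) - 1 - A := by abel
      _ = _ := by rw [q1]; abel
  have bD : D = -1 - bar D := by
    calc D = (bar D + D + 1) - 1 - bar D := by abel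
      _ = _ := by rw [q4]; abel
  have bC : bar C = -B := by
    rw [add_zero] at q2; exact eq_neg_of_add_eq_zero_left q2
  have bB : C = - bar B := by
    rw [add_zero] at q3; exact eq_neg_of_add_eq_zero_right q3
  have tA : trace A = -1 := by
    rw [bar] at bA
    have : trace A • (1 : M2 F) = -1 := by
      calc trace A • (1 : M2 F) = (trace A • 1 - A) + A := by abel
        _ = _ := by rw [bA]; abel
    simpa using congrFun (congrFun this 0) 0
  have dA : A.det = 1 - B.det := by
    rw [mul_bar, mul_bar] at r1
    have := congrFun (congrFun r1 0) 0
    simp at this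
    linear_combination this
  have hAB : A * B = B * bar D := by
    rw [bC] at r2
    have : A * B = A * B + (A * -B + B * bar D) := by rw [r2, add_zero]
    rw [this]; noncomm_ring
  by_cases hB : B.det = 0
  · exfalso
    -- invariant subspace
    have inv : ∀ z : Fin 2 → F, (fromBlocks 1 0 0 u *ᵥ Sum.elim (B *ᵥ z) 0 = Sum.elim (B *ᵥ z) 0) ∧
        (fromBlocks A B C D *ᵥ Sum.elim (B *ᵥ z) 0 = Sum.elim (B *ᵥ (bar D *ᵥ z)) 0) := by
      intro z
      rw [fromBlocks_mulVec, fromBlocks_mulVec]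
      simp only [Sum.elim_comp_inl, Sum.elim_comp_inr, mulVec_zero, add_zero, one_mulVec,
        zero_mulVec, mulVec_mulVec, hAB]
      rw [bB, neg_mul, bar_mul, hB]
      simp
    let L : (Fin 2 → F) →ₗ[F] (Fin 2 ⊕ Fin 2 → F) :=
      { toFun := fun z => Sum.elim z 0
        map_add' := by intro a b; ext i; cases i <;> simp
        map_smul' := by intro a b; ext i; cases i <;> simp }
    have hL : ∀ z, L z = Sum.elim z 0 := fun z => rfl
    have B0 : ∀ z, B *ᵥ z = 0 := by
      intro z
      by_contra hz
      have := irr_inv hirr (LinearMap.range (L ∘ₗ B.mulVecLin)) (by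
        rintro _ ⟨z, rfl⟩
        exact ⟨z, by simp only [LinearMap.comp_apply, mulVecLin_apply, hL, (inv z).1]⟩) (by
        rintro _ ⟨z, rfl⟩
        exact ⟨bar D *ᵥ z, by simp only [LinearMap.comp_apply, mulVecLin_apply, hL, (inv z).2]⟩)
        (v := L (B *ᵥ z)) ⟨z, rfl⟩ (by
          intro h; apply hz; ext i; exact congrFun h (Sum.inl i)) (Sum.elim 0 1)
      obtain ⟨z', hz'⟩ := this
      simpa [hL] using congrFun hz' (Sum.inr 0)
    have B00 : B = 0 := by
      apply Matrix.ext_of_mulVec_single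
      intro i; rw [B0, zero_mulVec]
    have C00 : C = 0 := by rw [bB, B00]; simp [bar]
    have := irr_inv hirr (LinearMap.range L) (by
        rintro _ ⟨z, rfl⟩
        exact ⟨z, by rw [hL, fromBlocks_mulVec]; simp⟩) (by
        rintro _ ⟨z, rfl⟩
        exact ⟨A *ᵥ z, by rw [hL, hL, fromBlocks_mulVec, B00, C00]; simp⟩)
        (v := L 1) ⟨1, rfl⟩ (by
          intro h; exact one_ne_zero (α := F) (congrFun h (Sum.inl 0))) (Sum.elim 0 1)
    obtain ⟨z', hz'⟩ := this
    simpa [hL] using congrFun hz' (Sum.inr 0)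
  · have hu : IsUnit B.det := isUnit_iff_ne_zero.mpr hB
    have hBi : B * B⁻¹ = 1 := mul_nonsing_inv B hu
    have hBi' : B⁻¹ * B = 1 := nonsing_inv_mul B hu
    apply good_conj (Q := (fromBlocks 1 0 0 B⁻¹ : M4 F)) (Qi := (fromBlocks 1 0 0 B : M4 F))
    · rw [fromBlocks_multiply, ← fromBlocks_one]; simp [hBi]
    · have e1 : (fromBlocks 1 0 0 B : M4 F) * fromBlocks 1 0 0 u * (fromBlocks 1 0 0 B⁻¹ : M4 F) =
        fromBlocks 1 0 0 (B * u * B⁻¹) := by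
        simp [fromBlocks_multiply]
      have e2 : (fromBlocks 1 0 0 B : M4 F) * fromBlocks A B C D * (fromBlocks 1 0 0 B⁻¹ : M4 F) =
        fromBlocks A 1 (-B.det • 1) (-1 - A) := by
        simp only [fromBlocks_multiply]
        have s1 : B * C = - B.det • 1 := by rw [bB, mul_neg, mul_bar]; simp
        have s2 : B * D * B⁻¹ = -1 - A := by
          rw [bD, mul_sub, ← hAB]
          calc (B * -1 - A * B) * B⁻¹ = - (B * B⁻¹) - A * (B * B⁻¹) := by noncomm_ring
            _ = _ := by rw [hBi, mul_one]
        simp [hBi, s1, s2]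
      rw [e1, e2]
      refine good_a h3 ?_ ?_ tA dA
      · rw [trace_mul_comm, ← mul_assoc, hBi', one_mul, tu]
      · rw [det_mul_right_comm, hBi, one_mul, du]

lemma ker_line {S : M2 F} (hS : S ≠ 0) {q r : Fin 2 → F} (hq : q ≠ 0) (h1 : S *ᵥ q = 0)
    (h2 : S *ᵥ r = 0) : ∃ l : F, r = l • q := by
  have key : q 0 * r 1 = q 1 * r 0 := by
    obtain ⟨i, hi⟩ := Function.ne_iff.mp hS
    obtain ⟨j, hj⟩ := Function.ne_iff.mp hi
    have a1 := congrFun h1 i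
    have a2 := congrFun h2 i
    simp only [mulVec, dotProduct, Fin.sum_univ_two, Pi.zero_apply] at a1 a2
    fin_cases j
    · apply mul_left_cancel₀ (show S i 0 ≠ 0 from hj)
      linear_combination r 1 * a1 - q 1 * a2
    · apply mul_left_cancel₀ (show S i 1 ≠ 0 from hj)
      linear_combination q 0 * a2 - r 0 * a1
  by_cases h0 : q 0 = 0
  · have hq1 : q 1 ≠ 0 := by
      intro h; apply hq; ext i; fin_cases i <;> simp [h0, h]
    refine ⟨r 1 / q 1, ?_⟩
    have : r 0 = 0 := by
      rw [h0, zero_mul] at key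
      exact (mul_eq_zero.mp key.symm).resolve_left hq1
    ext i; fin_cases i
    · simp [h0, this]
    · simp; field_simp
  · refine ⟨r 0 / q 0, ?_⟩
    ext i; fin_cases i
    · simp; field_simp
    · simp; field_simp; linear_combination key

end SpFour

namespace SpFour
open Matrix
variable {F : Type*} [Field F]

lemma blocks_sub (a b c d a' b' c' d' : M2 F) :
    fromBlocks a b c d - fromBlocks a' b' c' d' =
      fromBlocks (a - a') (b - b') (c - c') (d - d') := by
  ext (i | i) (j | j) <;> simp

/-- Algebra of an element of order three and its projection. -/
lemma proj_facts (h3 : (3 : F) ≠ 0) {y f : M4 F} (hy3 : y ^ 3 = 1)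
    (hf : (3 : F) • f = (2 : F) • 1 - y - y ^ 2) :
    f * f = f ∧ y * f = f * y ∧ (1 - f) * (y - 1) = 0 ∧ (y - 1) * (1 - f) = 0 := by
  have hf' : f = (3 : F)⁻¹ • ((2 : F) • 1 - y - y ^ 2) := by
    rw [← hf, smul_smul, inv_mul_cancel₀ h3, one_smul]
  obtain ⟨z, hz⟩ : ∃ z, z = y ^ 2 := ⟨_, rfl⟩
  have e1 : y * y = z := by rw [hz, pow_two]
  have e2 : y * z = 1 := by rw [hz, ← pow_succ', hy3]
  have e3 : z * y = 1 := by rw [hz, ← pow_succ, hy3]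
  have e4 : z * z = y := by
    rw [← e1, mul_assoc, ← mul_assoc y y y, e1, e3, mul_one]
  have e5 : (1 : M4 F) = ((3 : F)⁻¹ * 3) • 1 := by rw [inv_mul_cancel₀ h3, one_smul]
  have e6 : (1 : M4 F) - f = (3 : F)⁻¹ • (1 + y + z) := by
    rw [hf', ← hz]; nth_rewrite 1 [e5]; module
  refine ⟨?_, ?_, ?_, ?_⟩
  · have : f * ((3 : F) • f) = f * (3 : F) • 1 := by
      rw [hf, ← hz, hf', ← hz]
      simp only [smul_mul_assoc, mul_smul_comm, mul_sub, sub_mul, smul_sub, one_mul, mul_one, e1, e2, e3, e4]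
      module
    rw [mul_smul_comm, mul_smul_comm, mul_one] at this
    exact smul_right_injective _ h3 this
  · rw [hf', ← hz]
    simp only [smul_mul_assoc, mul_smul_comm, mul_sub, sub_mul, one_mul, mul_one, e1, e2, e3]
  · rw [e6]
    simp only [smul_mul_assoc, mul_sub, add_mul, one_mul, mul_one, e1, e3]
    module
  · rw [e6]
    simp only [mul_smul_comm, sub_mul, mul_add, one_mul, mul_one, e1, e2]
    module

/-- Type (1,1), generic. -/
lemma good_blocks_b1 {K : Subfield F} (h3 : (3 : F) ≠ 0) {u A B C D S : M2 F} {τ : F}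
    (tu : trace u = -1) (du : u.det = 1) (hy3 : (fromBlocks A B C D) ^ 3 = 1)
    (hf : (3 : F) • fromBlocks ((1 - τ) • 1) S (bar S) (τ • 1)
      = (2 : F) • 1 - (fromBlocks A B C D) - (fromBlocks A B C D) ^ 2)
    (tA : trace A = 2 - 3 * (1 - τ)) (tD : trace D = 2 - 3 * τ) (dS : S.det = τ * (1 - τ))
    (hS : S.det ≠ 0) :
    Good K (fromBlocks 1 0 0 u) (fromBlocks A B C D) := by
  have hu : IsUnit S.det := isUnit_iff_ne_zero.mpr hS
  have hBi : S * S⁻¹ = 1 := mul_nonsing_inv S hu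
  have hBi' : S⁻¹ * S = 1 := nonsing_inv_mul S hu
  have hτ : τ ≠ 0 := by rintro rfl; simp [dS] at hS
  obtain ⟨κ, hκ⟩ : ∃ κ, κ = τ * (1 - τ) := ⟨_, rfl⟩
  rw [← hκ] at dS
  have hQ : fromBlocks 1 0 0 S * fromBlocks 1 0 0 S⁻¹ = (1 : M4 F) := by
    rw [fromBlocks_multiply, ← fromBlocks_one]; simp [hBi]
  have hQ' := mul_eq_one_comm.mp hQ
  apply good_conj (Q := (fromBlocks 1 0 0 S⁻¹ : M4 F)) (Qi := (fromBlocks 1 0 0 S : M4 F)) hQ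
  have e1 : (fromBlocks 1 0 0 S : M4 F) * fromBlocks 1 0 0 u * (fromBlocks 1 0 0 S⁻¹ : M4 F) =
      fromBlocks 1 0 0 (S * u * S⁻¹) := by
    simp [fromBlocks_multiply]
  have e2 : (fromBlocks 1 0 0 S : M4 F) * fromBlocks A B C D * (fromBlocks 1 0 0 S⁻¹ : M4 F) =
      fromBlocks A (B * S⁻¹) (S * C) (S * D * S⁻¹) := by
    simp [fromBlocks_multiply]
  have e3 : (fromBlocks 1 0 0 S : M4 F) * fromBlocks ((1 - τ) • 1) S (bar S) (τ • 1) * (fromBlocks 1 0 0 S⁻¹ : M4 F) =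
      fromBlocks ((1 - τ) • 1) 1 (κ • 1) (τ • 1) := by
    simp [fromBlocks_multiply, hBi, mul_bar, dS]
  have hm : ∀ a b : M4 F, fromBlocks 1 0 0 S * (a * b) * (fromBlocks 1 0 0 S⁻¹ : M4 F) =
      (fromBlocks 1 0 0 S * a * fromBlocks 1 0 0 S⁻¹) *
      (fromBlocks 1 0 0 S * b * fromBlocks 1 0 0 S⁻¹) := by
    intro a b
    calc fromBlocks 1 0 0 S * (a * b) * fromBlocks 1 0 0 S⁻¹ =
        fromBlocks 1 0 0 S * a * 1 * b * fromBlocks 1 0 0 S⁻¹ := by noncomm_ring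
      _ = _ := by rw [← hQ']; noncomm_ring
  have hf' := congrArg (fun z => fromBlocks 1 0 0 S * z * fromBlocks 1 0 0 S⁻¹) hf
  have hy3' := congrArg (fun z => fromBlocks 1 0 0 S * z * fromBlocks 1 0 0 S⁻¹) hy3
  simp only [mul_sub, sub_mul, mul_smul_comm, smul_mul_assoc, mul_one, hQ, e3, e2, pow_succ, pow_zero, one_mul, hm] at hf' hy3'
  rw [e1, e2]
  have tD' : trace (S * D * S⁻¹) = 2 - 3 * τ := by
    rw [trace_mul_comm, ← mul_assoc, hBi', one_mul, tD]
  have tu' : trace (S * u * S⁻¹) = -1 := by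
    rw [trace_mul_comm, ← mul_assoc, hBi', one_mul, tu]
  have du' : (S * u * S⁻¹).det = 1 := by
    rw [det_mul_right_comm, hBi, one_mul, du]
  generalize B * S⁻¹ = B at *
  generalize S * C = C at *
  generalize S * D * S⁻¹ = D at *
  generalize S * u * S⁻¹ = u at *
  obtain ⟨-, -, p3, p4⟩ := proj_facts h3 (y := fromBlocks A B C D)
    (f := fromBlocks ((1 - τ) • 1) 1 (κ • 1) (τ • 1)) 
    (by simpa only [pow_succ, pow_zero, one_mul] using hy3')
    (by simpa only [pow_succ, pow_zero, one_mul] using hf')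
  rw [← fromBlocks_one, blocks_sub, blocks_sub, fromBlocks_multiply, ← fromBlocks_zero, fromBlocks_inj] at p3 p4
  obtain ⟨a1, a2, -, -⟩ := p3
  obtain ⟨-, b2, -, -⟩ := p4
  have c1 : C = τ • (A - 1) := by
    have : C = τ • (A - 1) - ((1 - (1 - τ) • 1) * (A - 1) + (0 - 1) * (C - 0)) := by
      simp only [sub_mul, one_mul, smul_mul_assoc, zero_mul, sub_zero]; module
    rw [this, a1, sub_zero]
  have c2 : D = 1 + τ • B := by
    have : D = 1 + τ • B - ((1 - (1 - τ) • 1) * (B - 0) + (0 - 1) * (D - 1)) := by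
      simp only [sub_mul, one_mul, smul_mul_assoc, zero_mul, sub_zero]; module
    rw [this, a2, sub_zero]
  have c3 : A = 1 + (1 - τ) • B := by
    have : A = 1 + (1 - τ) • B - ((A - 1) * (0 - 1) + (B - 0) * (1 - τ • 1)) := by
      simp only [mul_sub, mul_one, mul_smul_comm, mul_zero, sub_zero]; module
    rw [this, b2, sub_zero]
  obtain ⟨w, hw⟩ : ∃ w, w = 1 + B := ⟨_, rfl⟩
  have hB : B = w - 1 := by rw [hw]; abel
  have tw : trace w = -1 := by
    have h1 : trace B = -3 := by
      have i1 := tA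
      have i2 := tD'
      rw [c3] at i1
      rw [c2] at i2
      simp only [trace_add, trace_one, trace_smul, smul_eq_mul] at i1 i2
      simp at i1 i2
      linear_combination i1 + i2
    rw [hw, trace_add, h1, trace_one]; simp; ring
  have hww : w * w = -1 - w := by
    rw [← fromBlocks_one, fromBlocks_smul, fromBlocks_smul, fromBlocks_multiply, blocks_sub, blocks_sub, fromBlocks_inj] at hf'
    obtain ⟨-, f2, -, -⟩ := hf'
    rw [c2, c3, hB] at f2
    have : w * w = -1 - w + ((3 : F) • 1 - ((2 : F) • 0 - (w - 1) - ((1 + (1 - τ) • (w - 1)) * (w - 1) +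
      (w - 1) * (1 + τ • (w - 1))))) - ((3 : F) • 1 - (3 : F) • 1) + 0 := by
      simp only [mul_add, add_mul, sub_mul, mul_sub, mul_one, one_mul, smul_mul_assoc, mul_smul_comm]
      module
    rw [this, ← f2]; simp
  have dw : w.det = 1 := by
    rw [cayley2, tw] at hww
    have : w.det • (1 : M2 F) = 1 := by
      have : w.det • (1 : M2 F) = (-1 : F) • w - ((-1 : F) • w - w.det • 1) := by abel
      rw [this, hww]; module
    simpa using congrFun (congrFun this 0) 0
  have c1' : C = (τ * (1 - τ)) • (w - 1) := by
    rw [c1, c3, hB]; module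
  rw [c1', c2, c3, hB]
  exact good_b h3 hτ tu' du' tw dw hww

/-- Type (1,1), degenerate. -/
lemma good_blocks_b2 {K : Subfield F} (h3 : (3 : F) ≠ 0) {u S : M2 F} {y : M4 F}
    (tu : trace u = -1) (du : u.det = 1) (hirr : Irr (fromBlocks 1 0 0 u) y) (hy3 : y ^ 3 = 1)
    (hf : (3 : F) • fromBlocks 1 S (bar S) 0 = (2 : F) • 1 - y - y ^ 2)
    (dS : S.det = 0) (hS : S ≠ 0) :
    Good K (fromBlocks 1 0 0 u) y := by
  obtain ⟨p1, p2, p3, p4⟩ := proj_facts h3 hy3 hf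
  have hS' : bar S ≠ 0 := by
    intro h; apply hS; apply bar_inj; rw [h]; simp [bar]
  have dS' : (bar S).det = 0 := by
    by_contra h
    have hu : IsUnit (bar S).det := isUnit_iff_ne_zero.mpr h
    have h1 := mul_bar S
    rw [dS, zero_smul] at h1
    apply hS
    rw [← mul_one S, ← mul_nonsing_inv (bar S) hu, ← mul_assoc, h1, zero_mul]
  obtain ⟨q, hq0, hq⟩ := Matrix.exists_mulVec_eq_zero_iff.mpr dS
  obtain ⟨p, hp0, hp⟩ := Matrix.exists_mulVec_eq_zero_iff.mpr dS'
  set f : M4 F := fromBlocks 1 S (bar S) 0 with hfd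
  set x : M4 F := fromBlocks 1 0 0 u with hxd
  set Vq : Fin 2 ⊕ Fin 2 → F := Sum.elim 0 q with hVq
  set Vq' : Fin 2 ⊕ Fin 2 → F := Sum.elim 0 (u *ᵥ q) with hVq'
  set Vp : Fin 2 ⊕ Fin 2 → F := Sum.elim p 0 with hVp
  set Vp' : Fin 2 ⊕ Fin 2 → F := y *ᵥ Vp with hVp'
  have u2 : u * u = -1 - u := by rw [cayley2, tu, du]; module
  have x1 : x *ᵥ Vq = Vq' := by
    rw [hxd, hVq, fromBlocks_mulVec]; simp [hVq']
  have x2 : x *ᵥ Vq' = - Vq - Vq' := by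
    rw [hxd, hVq', fromBlocks_mulVec]
    simp only [Sum.elim_comp_inl, Sum.elim_comp_inr, mulVec_mulVec, u2, sub_mulVec, neg_mulVec]
    ext i
    cases i <;> simp only [Sum.elim_inl, Sum.elim_inr, hVq, Pi.sub_apply, Pi.neg_apply, mulVec_zero,
      zero_mulVec, one_mulVec, zero_mul, Pi.add_apply, Pi.zero_apply] <;> ring
  have x3 : x *ᵥ Vp = Vp := by
    rw [hxd, hVp, fromBlocks_mulVec]; simp
  have f1 : f *ᵥ Vp = Vp := by
    rw [hfd, hVp, fromBlocks_mulVec]; simp only [Sum.elim_comp_inl, Sum.elim_comp_inr, hp]; simp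
  have f2 : f *ᵥ Vq = 0 := by
    rw [hfd, hVq, fromBlocks_mulVec]; simp only [Sum.elim_comp_inl, Sum.elim_comp_inr, hq]; simp
  obtain ⟨m, hm⟩ : ∃ m : F, S *ᵥ (u *ᵥ q) = m • p := by
    apply ker_line hS' hp0 hp
    rw [mulVec_mulVec, bar_mul, dS]; simp
  have f3 : f *ᵥ Vq' = m • Vp := by
    rw [hfd, hVq', fromBlocks_mulVec]; simp only [Sum.elim_comp_inl, Sum.elim_comp_inr, hm]
    ext i; cases i <;> simp [hVp]
  have f4 : f *ᵥ Vp' = Vp' := by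
    rw [hVp', mulVec_mulVec, ← p2, ← mulVec_mulVec, f1]
  -- the second component of `Vp'`
  obtain ⟨l, hl⟩ : ∃ l : F, Vp' ∘ Sum.inr = l • q := by
    apply ker_line hS hq0 hq
    rw [← f4, hfd, fromBlocks_mulVec]
    simp only [Sum.elim_comp_inr, zero_mulVec, add_zero]
    rw [mulVec_mulVec, mul_bar, dS]; simp
  have y1 : y *ᵥ Vq = Vq := by
    have := congrArg (fun z => z *ᵥ Vq) p4
    simp only [← mulVec_mulVec, sub_mulVec, one_mulVec, f2, sub_zero, zero_mulVec] at this
    exact sub_eq_zero.mp this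
  have y2 : y *ᵥ Vq' = Vq' + m • (Vp' - Vp) := by
    have := congrArg (fun z => z *ᵥ Vq') p4
    simp only [← mulVec_mulVec, sub_mulVec, one_mulVec, f3, zero_mulVec, mulVec_sub, mulVec_smul, ← hVp'] at this
    have e : y *ᵥ Vq' = Vq' + m • (Vp' - Vp) + (y *ᵥ Vq' - Vq' - m • (Vp' - Vp)) := by module
    rw [e, this, add_zero]
  have y3 : y *ᵥ Vp' = - Vp - Vp' := by
    have := congrArg (fun z => z *ᵥ Vp) hf
    simp only [smul_mulVec, f1, sub_mulVec, one_mulVec, pow_two, ← mulVec_mulVec, ← hVp'] at this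
    have e : y *ᵥ Vp' = -Vp - Vp' + ((3 : F) • Vp - ((2 : F) • Vp - Vp' - y *ᵥ Vp')) - ((3 : F) • Vp - (3 : F) • Vp) := by module
    rw [e, ← this]; simp
  have x4 : x *ᵥ Vp' = Vp' + l • (Vq' - Vq) := by
    rw [hxd, fromBlocks_mulVec, hl]
    ext i
    cases i with
    | inl i => simp [hVq, hVq']
    | inr i =>
      have := congrFun hl i
      simp only [Function.comp_apply] at this
      simp only [zero_mulVec, zero_add, mulVec_smul, Sum.elim_inr, Pi.add_apply, Pi.smul_apply, Pi.sub_apply, this, hVq, hVq', smul_eq_mul]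
      ring
  set Q : M4 F := Matrix.of (fun i j => Sum.elim ![Vq, Vq'] ![Vp, Vp'] j i) with hQd
  have Qc : ∀ c : Fin 2 ⊕ Fin 2 → F, Q *ᵥ c = c (Sum.inl 0) • Vq + c (Sum.inl 1) • Vq' + 
      (c (Sum.inr 0) • Vp + c (Sum.inr 1) • Vp') := by
    intro c; ext i
    simp [mulVec, dotProduct, Fintype.sum_sum_type, Fin.sum_univ_two, hQd, mul_comm]
  set G1 : M4 F := fromBlocks !![0, -1; 1, -1] (l • !![0, -1; 0, 1]) 0 1 with hG1
  set G2 : M4 F := fromBlocks 1 0 (m • !![0, -1; 0, 1]) !![0, -1; 1, -1] with hG2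
  have hx : ∀ c, x *ᵥ (Q *ᵥ c) = Q *ᵥ (G1 *ᵥ c) := by
    intro c
    rw [Qc, Qc, mulVec_add, mulVec_add, mulVec_add, mulVec_smul, mulVec_smul, mulVec_smul, mulVec_smul,
      x1, x2, x3, x4, hG1, fromBlocks_mulVec]
    simp [dotProduct, Fin.sum_univ_two]
    module
  have hy : ∀ c, y *ᵥ (Q *ᵥ c) = Q *ᵥ (G2 *ᵥ c) := by
    intro c
    rw [Qc, Qc, mulVec_add, mulVec_add, mulVec_add, mulVec_smul, mulVec_smul, mulVec_smul, mulVec_smul,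
      y1, y2, y3, ← hVp', hG2, fromBlocks_mulVec]
    simp [dotProduct, Fin.sum_univ_two]
    module
  have hVp0 : Vp ≠ 0 := by
    intro h; apply hp0; ext i; exact congrFun h (Sum.inl i)
  have surj : Function.Surjective Q.mulVecLin := by
    intro w
    exact irr_inv hirr (LinearMap.range Q.mulVecLin) (by
      rintro _ ⟨c, rfl⟩; exact ⟨G1 *ᵥ c, (hx c).symm⟩) (by
      rintro _ ⟨c, rfl⟩; exact ⟨G2 *ᵥ c, (hy c).symm⟩) (v := Vp)
      ⟨Sum.elim 0 ![1, 0], by rw [mulVecLin_apply, Qc]; simp⟩ hVp0 w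
  have hQu : IsUnit Q := Matrix.mulVec_surjective_iff_isUnit.mp surj
  have hQu' := (Matrix.isUnit_iff_isUnit_det _).mp hQu
  apply good_conj (nonsing_inv_mul Q hQu')
  have ex : x * Q = Q * G1 := by
    apply Matrix.ext_of_mulVec_single
    intro i; rw [← mulVec_mulVec, ← mulVec_mulVec, hx]
  have ey : y * Q = Q * G2 := by
    apply Matrix.ext_of_mulVec_single
    intro i; rw [← mulVec_mulVec, ← mulVec_mulVec, hy]
  rw [mul_assoc, mul_assoc, ex, ey, nonsing_inv_mul_cancel_left _ _ hQu', nonsing_inv_mul_cancel_left _ _ hQu']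
  exact good_c

end SpFour

namespace SpFour
open Matrix
variable {F : Type*} [Field F]

/-- First generator in normal form, all cases for the second one. -/
lemma good_blocks {K : Subfield F} (h3 : (3 : F) ≠ 0) {u A B C D : M2 F} (tu : trace u = -1)
    (du : u.det = 1) (hirr : Irr (fromBlocks 1 0 0 u) (fromBlocks A B C D))
    (hy2 : (fromBlocks A B C D) ^ 2 = fromBlocks (bar A) (bar C) (bar B) (bar D))
    (hy3 : (fromBlocks A B C D) ^ 3 = 1) (hy1 : fromBlocks A B C D ≠ 1) :
    Good K (fromBlocks 1 0 0 u) (fromBlocks A B C D) := by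
  by_cases hq : (fromBlocks A B C D) ^ 2 + (fromBlocks A B C D) + 1 = 0
  · exact good_blocks_a h3 tu du hirr hy2 hq hy3
  obtain ⟨σ, hσ⟩ : ∃ σ : F, trace A = 2 - 3 * σ := ⟨(2 - trace A) / 3, by field_simp; ring⟩
  obtain ⟨τ, hτ⟩ : ∃ τ : F, trace D = 2 - 3 * τ := ⟨(2 - trace D) / 3, by field_simp; ring⟩
  obtain ⟨S, hS⟩ : ∃ S : M2 F, S = (-(3 : F)⁻¹) • (B + bar C) := ⟨_, rfl⟩
  have h33 : (3 : F) * -(3 : F)⁻¹ = -1 := by rw [mul_neg, mul_inv_cancel₀ h3]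
  have hf : (3 : F) • fromBlocks (σ • 1) S (bar S) (τ • 1)
      = (2 : F) • 1 - (fromBlocks A B C D) - (fromBlocks A B C D) ^ 2 := by
    rw [hy2, ← fromBlocks_one, fromBlocks_smul, fromBlocks_smul, blocks_sub, blocks_sub]
    congr 1
    · rw [bar, hσ]; module
    · rw [hS, smul_smul, h33]; module
    · rw [hS, bar_smul, bar_add, bar_bar, smul_smul, h33]; module
    · rw [bar, hτ]; module
  obtain ⟨p1, p2, p3, p4⟩ := proj_facts h3 hy3 hf
  have p1' := p1
  rw [fromBlocks_multiply, fromBlocks_inj] at p1'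
  obtain ⟨a1, a2, -, a4⟩ := p1'
  have b1 : σ * σ + S.det = σ := by
    rw [mul_bar] at a1
    simpa using congrFun (congrFun a1 0) 0
  have b4 : S.det + τ * τ = τ := by
    rw [bar_mul] at a4
    simpa using congrFun (congrFun a4 0) 0
  have b2 : (σ + τ - 1) • S = 0 := by
    simp only [smul_mul_assoc, mul_smul_comm, one_mul, mul_one] at a2
    have : (σ + τ - 1) • S = (σ • S + τ • S) - S := by module
    rw [this, a2, sub_self]
  have hS0 : S ≠ 0 := by
    intro h0
    obtain ⟨c, hc⟩ := irr_comm hirr (fromBlocks (σ • 1) S (bar S) (τ • 1)) (by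
      rw [fromBlocks_multiply, fromBlocks_multiply, h0]; simp [bar]) p2
    have hcc : c * c = c := by
      rw [hc] at p1
      simpa using congrFun (congrFun p1 (Sum.inl 0)) (Sum.inl 0)
    have : c * (c - 1) = 0 := by rw [mul_sub, hcc]; ring
    rcases mul_eq_zero.mp this with h | h
    · rw [hc, h] at p4
      apply hy1
      simpa [sub_eq_zero] using p4
    · have h1 : c = 1 := sub_eq_zero.mp h
      rw [hc, h1, one_smul] at hf
      apply hq
      have : (fromBlocks A B C D) ^ 2 + (fromBlocks A B C D) + 1 =
        (3 : F) • 1 - ((2 : F) • 1 - (fromBlocks A B C D) - (fromBlocks A B C D) ^ 2) - 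
          ((3 : F) • 1 - (3 : F) • 1) := by module
      rw [this]
      nth_rewrite 1 [hf]
      simp
  have hst : σ = 1 - τ := by
    rcases smul_eq_zero.mp b2 with h | h
    · linear_combination h
    · exact absurd h hS0
  subst hst
  have dS : S.det = τ * (1 - τ) := by linear_combination b4
  by_cases hd : S.det = 0
  · rw [hd] at dS
    rcases mul_eq_zero.mp dS.symm with h | h
    · subst h
      rw [sub_zero, one_smul, zero_smul] at hf
      exact good_blocks_b2 h3 tu du hirr hy3 hf hd hS0
    · exfalso
      have h1 : τ = 1 := by linear_combination -h
      subst h1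
      have dS' : (bar S).det = 0 := by
        by_contra h
        have hu : IsUnit (bar S).det := isUnit_iff_ne_zero.mpr h
        have h1 := mul_bar S
        rw [hd, zero_smul] at h1
        apply hS0
        rw [← mul_one S, ← mul_nonsing_inv (bar S) hu, ← mul_assoc, h1, zero_mul]
      obtain ⟨p, hp0, hp⟩ := Matrix.exists_mulVec_eq_zero_iff.mpr dS'
      have f2 : fromBlocks ((1 - 1 : F) • 1) S (bar S) ((1 : F) • 1) *ᵥ Sum.elim p 0 = 0 := by
        rw [fromBlocks_mulVec]; simp only [Sum.elim_comp_inl, Sum.elim_comp_inr, hp]; simp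
      have hv := irr_no_fix tu du h3 hirr (Sum.elim p 0) (by rw [fromBlocks_mulVec]; simp) (by
        have := congrArg (fun z => z *ᵥ Sum.elim p 0) p4
        simp only [← mulVec_mulVec] at this
        rw [sub_mulVec 1, f2, one_mulVec, sub_zero, sub_mulVec, one_mulVec, zero_mulVec] at this
        exact sub_eq_zero.mp this)
      apply hp0; ext i; exact congrFun hv (Sum.inl i)
  · exact good_blocks_b1 h3 tu du hy3 hf hσ hτ dS hd

/-- The symplectic form. -/
def B4 (v w : Fin 2 ⊕ Fin 2 → F) : F := v ⬝ᵥ (J (Fin 2) F *ᵥ w)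

lemma B4_self (v : Fin 2 ⊕ Fin 2 → F) : B4 v v = 0 := by
  simp [B4, J, fromBlocks_mulVec, dotProduct, Fintype.sum_sum_type, Fin.sum_univ_two, neg_mulVec]
  ring

lemma B4_neg (v w : Fin 2 ⊕ Fin 2 → F) : B4 w v = - B4 v w := by
  simp [B4, J, fromBlocks_mulVec, dotProduct, Fintype.sum_sum_type, Fin.sum_univ_two, neg_mulVec]
  ring

lemma B4_nondeg {v : Fin 2 ⊕ Fin 2 → F} (hv : v ≠ 0) : ∃ w, B4 v w = 1 := by
  have h : v ᵥ* J (Fin 2) F ≠ 0 := by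
    intro h
    apply hv
    have := congrArg (fun z => z ᵥ* J (Fin 2) F) h
    simp only [vecMul_vecMul, J_squared, zero_vecMul, vecMul_neg, vecMul_one] at this
    exact neg_eq_zero.mp this
  obtain ⟨i, hi⟩ := Function.ne_iff.mp h
  refine ⟨Pi.single i ((v ᵥ* J (Fin 2) F) i)⁻¹, ?_⟩
  rw [B4, dotProduct_mulVec, dotProduct_single, mul_inv_cancel₀ hi]

lemma B4_adj {e : M4 F} (he : eᵀ * J (Fin 2) F = J (Fin 2) F * e) (v w : Fin 2 ⊕ Fin 2 → F) :
    B4 (e *ᵥ v) w = B4 v (e *ᵥ w) := by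
  rw [B4, B4, mulVec_mulVec, ← he, ← mulVec_mulVec, dotProduct_mulVec v, vecMul_transpose]

lemma plane {e : M4 F} (he : eᵀ * J (Fin 2) F = J (Fin 2) F * e) (hi : e * e = e) (h0 : e ≠ 0) :
    ∃ v w, e *ᵥ v = v ∧ e *ᵥ w = w ∧ B4 v w = 1 := by
  obtain ⟨z, hz⟩ : ∃ z, e *ᵥ z ≠ 0 := by
    by_contra! h
    apply h0
    apply Matrix.ext_of_mulVec_single
    intro i; rw [h, zero_mulVec]
  obtain ⟨w, hw⟩ := B4_nondeg hz
  have hi' : ∀ z, e *ᵥ (e *ᵥ z) = e *ᵥ z := fun z => by rw [mulVec_mulVec, hi]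
  refine ⟨e *ᵥ z, e *ᵥ w, hi' z, hi' w, ?_⟩
  rw [← B4_adj he, hi', hw]

/-- The matrix with given columns. -/
def cols (v w v' w' : Fin 2 ⊕ Fin 2 → F) : M4 F :=
  Matrix.of (fun i j => Sum.elim ![v, w] ![v', w'] j i)

lemma cols_mulVec (v w v' w' c : Fin 2 ⊕ Fin 2 → F) : cols v w v' w' *ᵥ c =
    c (Sum.inl 0) • v + c (Sum.inl 1) • w + (c (Sum.inr 0) • v' + c (Sum.inr 1) • w') := by
  ext i
  simp [mulVec, dotProduct, Fintype.sum_sum_type, Fin.sum_univ_two, cols, mul_comm]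

lemma cols_gram (v w v' w' : Fin 2 ⊕ Fin 2 → F) :
    (cols v w v' w')ᵀ * J (Fin 2) F * cols v w v' w' =
    fromBlocks !![0, B4 v w; -B4 v w, 0] !![B4 v v', B4 v w'; B4 w v', B4 w w']
      !![-B4 v v', -B4 w v'; -B4 v w', -B4 w w'] !![0, B4 v' w'; -B4 v' w', 0] := by
  have key : ∀ i j, ((cols v w v' w')ᵀ * J (Fin 2) F * cols v w v' w') i j =
      B4 (Sum.elim ![v, w] ![v', w'] i) (Sum.elim ![v, w] ![v', w'] j) := by
    intro i j
    rw [mul_assoc, mul_apply']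
    rfl
  ext i j
  rw [key]
  rcases i with i | i <;> rcases j with j | j <;> fin_cases i <;> fin_cases j <;>
    simp [B4_self] <;> exact B4_neg _ _

/-- The 2 × 2 symplectic matrix. -/
def jj : M2 F := !![0, 1; -1, 0]

lemma jj_sq : (jj : M2 F) * jj = -1 := by
  ext i j; fin_cases i <;> fin_cases j <;> simp [jj]

lemma sq_adj {x : M4 F} (h3 : x ^ 3 = 1) (hx : xᵀ * J (Fin 2) F = J (Fin 2) F * x ^ 2) :
    (x ^ 2)ᵀ * J (Fin 2) F = J (Fin 2) F * x := by
  rw [transpose_pow, pow_two, mul_assoc, hx, ← mul_assoc, hx, mul_assoc]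
  congr 1
  calc x ^ 2 * x ^ 2 = x ^ 3 * x := by noncomm_ring
    _ = x := by rw [h3, one_mul]

/-- In characteristic three every symplectic element of order three is quadratic. -/
lemma char_three (h0 : (3 : F) = 0) {x : M4 F} (h3 : x ^ 3 = 1)
    (hx : xᵀ * J (Fin 2) F = J (Fin 2) F * x ^ 2) : x ^ 2 + x + 1 = 0 := by
  obtain ⟨N, hN⟩ : ∃ N, N = x ^ 2 + x + 1 := ⟨_, rfl⟩
  have hNJ : Nᵀ * J (Fin 2) F = J (Fin 2) F * N := by
    rw [hN, transpose_add, transpose_add, add_mul, add_mul, sq_adj h3 hx, hx, transpose_one]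
    noncomm_ring
  have hxN : x * N = N := by
    rw [hN, mul_add, mul_add, ← pow_succ', h3]; noncomm_ring
  have hNx : N * x = N := by
    rw [hN, add_mul, add_mul, ← pow_succ, h3]; noncomm_ring
  have h30 : (3 : M4 F) = 0 := by
    have : (3 : M4 F) = algebraMap F (M4 F) 3 := (map_ofNat (algebraMap F (M4 F)) 3).symm
    rw [this, h0, map_zero]
  have hNN : N * N = 0 := by
    nth_rewrite 1 [hN]
    rw [add_mul, add_mul, pow_two, mul_assoc, hxN, hxN, one_mul]
    calc N + N + N = 3 * N := by noncomm_ring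
      _ = 0 := by rw [h30, zero_mul]
  have hn : N = (x - 1) * (x - 1) := by
    have : (x - 1) * (x - 1) = x ^ 2 + x + 1 - 3 * x := by noncomm_ring
    rw [this, h30, hN]; simp
  rw [← hN]
  by_contra hN0
  obtain ⟨v, hv⟩ : ∃ z, N *ᵥ z ≠ 0 := by
    by_contra! h
    apply hN0
    apply Matrix.ext_of_mulVec_single
    intro i; rw [h, zero_mulVec]
  obtain ⟨w, hw⟩ := B4_nondeg hv
  have h2 : (2 : F) ≠ 0 := by
    intro h; apply one_ne_zero (α := F); linear_combination h0 - h
  have self0 : ∀ z, B4 z (N *ᵥ z) = 0 := by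
    intro z
    have a := B4_neg z (N *ᵥ z)
    rw [B4_adj hNJ] at a
    apply (mul_eq_zero.mp (show 2 * B4 z (N *ᵥ z) = 0 by linear_combination a)).resolve_left h2
  have g1 : B4 v (N *ᵥ w) = 1 := by rw [← B4_adj hNJ, hw]
  have g2 : B4 w (N *ᵥ v) = -1 := by rw [B4_neg (N *ᵥ v) w, hw]
  have g3 : B4 (N *ᵥ v) (N *ᵥ w) = 0 := by
    rw [B4_adj hNJ, mulVec_mulVec, hNN, zero_mulVec]; simp [B4]
  have gram := cols_gram v w (N *ᵥ v) (N *ᵥ w)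
  rw [self0, self0, g1, g2, g3] at gram
  have hinv : (fromBlocks 0 (-jj) (-jj) (B4 v w • jj) * (cols v w (N *ᵥ v) (N *ᵥ w))ᵀ * J (Fin 2) F)
     * cols v w (N *ᵥ v) (N *ᵥ w) = 1 := by
    rw [mul_assoc, mul_assoc, ← mul_assoc (cols v w (N *ᵥ v) (N *ᵥ w))ᵀ, gram, fromBlocks_multiply, ← fromBlocks_one]
    congr 1 <;> ext i j <;> fin_cases i <;> fin_cases j <;> simp [jj]
  have hinv' := mul_eq_one_comm.mp hinv
  obtain ⟨c, hc⟩ : ∃ c, cols v w (N *ᵥ v) (N *ᵥ w) *ᵥ c = (x - 1) *ᵥ v :=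
    ⟨(fromBlocks 0 (-jj) (-jj) (B4 v w • jj) * (cols v w (N *ᵥ v) (N *ᵥ w))ᵀ * J (Fin 2) F) *ᵥ ((x - 1) *ᵥ v),
      by rw [mulVec_mulVec, hinv', one_mulVec]⟩
  rw [cols_mulVec] at hc
  have k1 : N *ᵥ ((x - 1) *ᵥ v) = 0 := by
    rw [mulVec_mulVec, mul_sub, hNx, mul_one, sub_self, zero_mulVec]
  have k2 : c (Sum.inl 0) • (N *ᵥ v) + c (Sum.inl 1) • (N *ᵥ w) = 0 := by
    rw [← k1, ← hc]
    simp only [mulVec_add, mulVec_smul, mulVec_mulVec, hNN, zero_mulVec, smul_zero, add_zero]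
  have c1 : c (Sum.inl 1) = 0 := by
    have := congrArg (B4 v) k2
    simp only [B4, mulVec_add, mulVec_smul, dotProduct_add, dotProduct_smul, mulVec_zero, dotProduct_zero] at this
    change _ • B4 v (N *ᵥ v) + _ • B4 v (N *ᵥ w) = 0 at this
    rw [self0, g1] at this
    simpa using this
  have c0 : c (Sum.inl 0) = 0 := by
    have := congrArg (B4 w) k2
    simp only [B4, mulVec_add, mulVec_smul, dotProduct_add, dotProduct_smul, mulVec_zero, dotProduct_zero] at this
    change _ • B4 w (N *ᵥ v) + _ • B4 w (N *ᵥ w) = 0 at this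
    rw [self0, g2] at this
    simpa using this
  apply hv
  have hnN : (x - 1) * N = 0 := by rw [sub_mul, hxN, one_mul, sub_self]
  rw [hn, ← mulVec_mulVec, ← hc, c0, c1]
  simp only [mulVec_add, mulVec_smul, mulVec_mulVec, hnN, zero_mulVec, smul_zero, add_zero, zero_smul, mulVec_zero]

/-- Main case: the first generator is not quadratic. -/
lemma good_main {K : Subfield F} (h3 : (3 : F) ≠ 0) {x y : M4 F} (hirr : Irr x y)
    (hx : xᵀ * J (Fin 2) F = J (Fin 2) F * x ^ 2) (hy : yᵀ * J (Fin 2) F = J (Fin 2) F * y ^ 2)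
    (hx3 : x ^ 3 = 1) (hy3 : y ^ 3 = 1) (hx1 : x ≠ 1) (hy1 : y ≠ 1)
    (hq : x ^ 2 + x + 1 ≠ 0) : Good K x y := by
  obtain ⟨f, hfd⟩ : ∃ f : M4 F, f = (3 : F)⁻¹ • ((2 : F) • 1 - x - x ^ 2) := ⟨_, rfl⟩
  have hf : (3 : F) • f = (2 : F) • 1 - x - x ^ 2 := by
    rw [hfd, smul_smul, mul_inv_cancel₀ h3, one_smul]
  obtain ⟨p1, p2, p3, p4⟩ := proj_facts h3 hx3 hf
  have hfJ : fᵀ * J (Fin 2) F = J (Fin 2) F * f := by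
    rw [hfd]
    simp only [transpose_smul, transpose_sub, smul_mul_assoc, sub_mul, sq_adj hx3 hx, hx, transpose_one,
      mul_smul_comm, mul_sub, one_mul, mul_one]
    module
  have heJ : (1 - f)ᵀ * J (Fin 2) F = J (Fin 2) F * (1 - f) := by
    rw [transpose_sub, sub_mul, hfJ, transpose_one]; noncomm_ring
  have hf0 : f ≠ 0 := by
    intro h; rw [h] at p4; apply hx1; simpa [sub_eq_zero] using p4
  have he0 : 1 - f ≠ 0 := by
    intro h
    have h1 : f = 1 := (sub_eq_zero.mp h).symm
    apply hq
    have e : x ^ 2 + x + 1 = (3 : F) • 1 - ((2 : F) • 1 - x - x ^ 2) := by module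
    rw [e, ← hf, h1, sub_self]
  have hee : (1 - f) * (1 - f) = 1 - f := by
    calc (1 - f) * (1 - f) = 1 - f - f + f * f := by noncomm_ring
      _ = _ := by rw [p1]; abel
  obtain ⟨v, w, hv, hw, hvw⟩ := plane heJ hee he0
  obtain ⟨v', w', hv', hw', hvw'⟩ := plane hfJ p1 hf0
  have fz : ∀ z, (1 - f) *ᵥ z = z → f *ᵥ z = 0 := by
    intro z hz
    rw [sub_mulVec, one_mulVec] at hz
    exact sub_eq_self.mp hz
  have orth : ∀ a b, (1 - f) *ᵥ a = a → f *ᵥ b = b → B4 a b = 0 := by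
    intro a b ha hb
    rw [← hb, ← B4_adj hfJ, fz a ha]; simp [B4]
  have gram := cols_gram v w v' w'
  rw [orth v v' hv hv', orth v w' hv hw', orth w v' hw hv', orth w w' hw hw', hvw, hvw'] at gram
  set Q := cols v w v' w' with hQd
  have z2 : (!![0, 0; 0, 0] : M2 F) = 0 := by
    ext i j; fin_cases i <;> fin_cases j <;> rfl
  have gram' : Qᵀ * J (Fin 2) F * Q = fromBlocks jj 0 0 jj := by
    rw [gram, neg_zero, z2]; rfl
  obtain ⟨Qi, hQid⟩ : ∃ Qi : M4 F, Qi = fromBlocks (-jj) 0 0 (-jj) * (Qᵀ * J (Fin 2) F) := ⟨_, rfl⟩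
  have hQ : Qi * Q = 1 := by
    rw [hQid, mul_assoc, gram', fromBlocks_multiply, ← fromBlocks_one]
    simp [jj_sq]
  have hQ' : Q * Qi = 1 := mul_eq_one_comm.mp hQ
  have hfQ : f * Q = Q * fromBlocks 0 0 0 1 := by
    apply Matrix.ext_of_mulVec_single
    intro i
    rw [← mulVec_mulVec, ← mulVec_mulVec, hQd, cols_mulVec, cols_mulVec, fromBlocks_mulVec]
    simp only [mulVec_add, mulVec_smul, fz v hv, fz w hw, hv', hw']
    simp
  have hm : ∀ a b : M4 F, Qi * (a * b) * Q = (Qi * a * Q) * (Qi * b * Q) := by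
    intro a b
    calc Qi * (a * b) * Q = Qi * a * 1 * b * Q := by noncomm_ring
      _ = _ := by rw [← hQ']; noncomm_ring
  have hmp : ∀ (a : M4 F) (n : ℕ), (Qi * a * Q) ^ n = Qi * a ^ n * Q := by
    intro a n
    induction n with
    | zero => simp [hQ]
    | succ n ih => rw [pow_succ, ih, pow_succ, hm]
  -- adjoints after conjugation
  have adj : ∀ a : M4 F, aᵀ * J (Fin 2) F = J (Fin 2) F * a ^ 2 → ∀ A B C D : M2 F,
      Qi * a * Q = fromBlocks A B C D →
      (fromBlocks A B C D) ^ 2 = fromBlocks (bar A) (bar C) (bar B) (bar D) := by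
    intro a ha A B C D hd
    have h1 : (Qi * a * Q)ᵀ * fromBlocks jj 0 0 jj = fromBlocks jj 0 0 jj * (Qi * a * Q) ^ 2 := by
      rw [← gram', hmp, transpose_mul, transpose_mul]
      have t1 : Qiᵀ * Qᵀ = 1 := by rw [← transpose_mul, hQ', transpose_one]
      calc Qᵀ * (aᵀ * Qiᵀ) * (Qᵀ * J (Fin 2) F * Q) = Qᵀ * aᵀ * (Qiᵀ * Qᵀ) * J (Fin 2) F * Q := by
            noncomm_ring
        _ = Qᵀ * (aᵀ * J (Fin 2) F) * Q := by rw [t1]; noncomm_ring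
        _ = Qᵀ * J (Fin 2) F * 1 * a ^ 2 * Q := by rw [ha]; noncomm_ring
        _ = _ := by rw [← hQ']; noncomm_ring
    rw [hd] at h1
    have h2 : (fromBlocks A B C D) ^ 2 = fromBlocks (-jj) 0 0 (-jj) * 
        (fromBlocks jj 0 0 jj * (fromBlocks A B C D) ^ 2) := by
      rw [← mul_assoc, fromBlocks_multiply]
      simp [jj_sq]
    have h4 : ∀ A : M2 F, -(jj * (Aᵀ * jj)) = bar A := by
      intro A
      ext i j
      rw [neg_apply, mul_apply, Fin.sum_univ_two, mul_apply, mul_apply, Fin.sum_univ_two, Fin.sum_univ_two]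
      fin_cases i <;> fin_cases j <;> simp [jj, bar, trace_fin_two]
    rw [h2, ← h1, fromBlocks_transpose, fromBlocks_multiply, fromBlocks_multiply]
    simp [h4]
  apply good_conj hQ
  have hirr' := irr_conj hirr hQ
  obtain ⟨x', hx'⟩ : ∃ x', x' = Qi * x * Q := ⟨_, rfl⟩
  obtain ⟨y', hy'⟩ : ∃ y', y' = Qi * y * Q := ⟨_, rfl⟩
  have hx3' : x' ^ 3 = 1 := by rw [hx', hmp, hx3, mul_one, hQ]
  have hy3' : y' ^ 3 = 1 := by rw [hy', hmp, hy3, mul_one, hQ]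
  have hy1' : y' ≠ 1 := by
    intro h; apply hy1
    calc y = (Q * Qi) * y * (Q * Qi) := by rw [hQ']; simp
      _ = Q * (Qi * y * Q) * Qi := by noncomm_ring
      _ = 1 := by rw [← hy', h, mul_one, hQ']
  have hf' : (3 : F) • fromBlocks 0 0 0 1 = (2 : F) • 1 - x' - x' ^ 2 := by
    have e : (fromBlocks 0 0 0 1 : M4 F) = Qi * f * Q := by
      rw [mul_assoc, hfQ, ← mul_assoc, hQ, one_mul]
    have e2 : (3 : F) • (Qi * f * Q) = Qi * ((3 : F) • f) * Q := by
      rw [mul_smul_comm, smul_mul_assoc]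
    rw [e, e2, hf, hx', hmp]
    simp only [mul_sub, sub_mul, mul_smul_comm, smul_mul_assoc, mul_one, hQ]
  obtain ⟨-, -, q3, q4⟩ := proj_facts h3 hx3' hf'
  have ax := adj x hx
  have ay := adj y hy
  rw [← hx', ← hy'] at hirr'
  rw [← hx'] at ax
  rw [← hy'] at ay
  rw [← hx', ← hy']
  clear_value Q
  obtain ⟨a, b, c, u, rfl⟩ : ∃ a b c u, x' = fromBlocks a b c u :=
    ⟨_, _, _, _, (fromBlocks_toBlocks x').symm⟩
  obtain ⟨A, B, C, D, rfl⟩ : ∃ A B C D, y' = fromBlocks A B C D :=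
    ⟨_, _, _, _, (fromBlocks_toBlocks y').symm⟩
  have ax' := ax _ _ _ _ rfl
  have ay' := ay _ _ _ _ rfl
  have q3' := q3
  have q4' := q4
  rw [← fromBlocks_one, blocks_sub, blocks_sub, fromBlocks_multiply, ← fromBlocks_zero, fromBlocks_inj] at q3' q4'
  obtain ⟨r1, r2, -, -⟩ := q3'
  obtain ⟨-, -, r3, -⟩ := q4'
  simp only [sub_zero, one_mul, mul_one, zero_mul, mul_zero, add_zero, sub_self] at r1 r2 r3
  have r1' := sub_eq_zero.mp r1
  subst r1' r2 r3
  rw [ax', ← fromBlocks_one, fromBlocks_smul, fromBlocks_smul, blocks_sub, blocks_sub, fromBlocks_inj] at hf'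
  obtain ⟨-, -, -, s4⟩ := hf'
  have tu : trace u = -1 := by
    rw [bar] at s4
    have := congrFun (congrFun s4 0) 0
    simp at this
    linear_combination this
  have du : u.det = 1 := by
    rw [pow_succ', ax', fromBlocks_multiply, ← fromBlocks_one, fromBlocks_inj] at hx3'
    have := hx3'.2.2.2
    rw [mul_bar u] at this
    simpa using congrFun (congrFun this 0) 0
  exact good_blocks h3 tu du hirr' ay' hy3' hy1'

lemma tr_adj {M M' : M4 F} (h : Mᵀ * J (Fin 2) F = J (Fin 2) F * M') : trace M = trace M' := by
  have hJ : J (Fin 2) F * -J (Fin 2) F = 1 := by rw [mul_neg, J_squared, neg_neg]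
  have hJ' : -J (Fin 2) F * J (Fin 2) F = 1 := mul_eq_one_comm.mp hJ
  calc trace M = trace (Mᵀ * J (Fin 2) F * -J (Fin 2) F) := by
        rw [mul_assoc, hJ, mul_one, trace_transpose]
    _ = trace M' := by rw [h, trace_mul_comm, ← mul_assoc, hJ', one_mul]

lemma good_core {K : Subfield F} {x y : M4 F} (hirr : Irr x y)
    (hx : xᵀ * J (Fin 2) F = J (Fin 2) F * x ^ 2) (hy : yᵀ * J (Fin 2) F = J (Fin 2) F * y ^ 2)
    (hx3 : x ^ 3 = 1) (hy3 : y ^ 3 = 1) (hx1 : x ≠ 1) (hy1 : y ≠ 1) : Good K x y := by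
  by_cases h3 : (3 : F) = 0
  · exact (not_irr_quad hirr (char_three h3 hx3 hx) (char_three h3 hy3 hy)).elim
  by_cases hqx : x ^ 2 + x + 1 = 0
  · by_cases hqy : y ^ 2 + y + 1 = 0
    · exact (not_irr_quad hirr hqx hqy).elim
    · have hirr' : Irr y x := by
        unfold Irr at *; rw [Set.pair_comm]; exact hirr
      have := good_main (K := K) h3 hirr' hy hx hy3 hx3 hy1 hx1 hqy
      have hx' := sq_adj hx3 hx
      have hy' := sq_adj hy3 hy
      have t2 : trace (x * y ^ 2) = trace (y * x ^ 2) := by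
        apply tr_adj
        rw [transpose_mul, mul_assoc, hx, ← mul_assoc, hy', mul_assoc]
      have t3 : trace (x * y * (x ^ 2 * y ^ 2)) = trace (y * x * (y ^ 2 * x ^ 2)) := by
        apply tr_adj
        have e1 : (x * y * (x ^ 2 * y ^ 2))ᵀ * J (Fin 2) F =
            (y ^ 2)ᵀ * ((x ^ 2)ᵀ * (yᵀ * (xᵀ * J (Fin 2) F))) := by
          simp only [transpose_mul, mul_assoc]
        rw [e1, hx, ← mul_assoc yᵀ, hy, mul_assoc, ← mul_assoc (x ^ 2)ᵀ, hx', mul_assoc,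
          ← mul_assoc (y ^ 2)ᵀ, hy']
        simp only [mul_assoc]
      unfold Good at *
      rw [trace_mul_comm x y, t2, t3, charpoly_mul_comm x y, Set.pair_comm x y]
      exact this
  · exact good_main h3 hirr hx hy hx3 hy3 hx1 hy1 hqx

lemma adj_of_mem {x : M4 F} (h : x ∈ symplecticGroup (Fin 2) F) (h3 : x ^ 3 = 1) :
    xᵀ * J (Fin 2) F = J (Fin 2) F * x ^ 2 := by
  have h1 := SymplecticGroup.mem_iff'.mp h
  calc xᵀ * J (Fin 2) F = xᵀ * J (Fin 2) F * x ^ 3 := by rw [h3, mul_one]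
    _ = (xᵀ * J (Fin 2) F * x) * x ^ 2 := by noncomm_ring
    _ = _ := by rw [h1]

end SpFour

theorem stmt_12 {F : Type*} [Field F] [IsAlgClosed F]
    (g₁ g₂ : Matrix (Fin 2 ⊕ Fin 2) (Fin 2 ⊕ Fin 2) F)
    (hg₁ : g₁ ∈ Matrix.symplecticGroup (Fin 2) F)
    (hg₂ : g₂ ∈ Matrix.symplecticGroup (Fin 2) F)
    (h₁ : g₁ ^ 3 = 1) (h₁' : g₁ ≠ 1) (h₂ : g₂ ^ 3 = 1) (h₂' : g₂ ≠ 1)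
    (hirr : Algebra.adjoin F {g₁, g₂} = ⊤) :
    Subfield.closure
        {x : F | ∃ m ∈ Submonoid.closure ({g₁, g₂} :
          Set (Matrix (Fin 2 ⊕ Fin 2) (Fin 2 ⊕ Fin 2) F)), x = Matrix.trace m} =
      Subfield.closure {Matrix.trace (g₁ * g₂), (g₁ * g₂).charpoly.coeff 2,
        Matrix.trace (g₁ * g₂⁻¹)} := by
  have hinv : g₂⁻¹ = g₂ ^ 2 := by
    apply Matrix.inv_eq_right_inv
    rw [← pow_succ', h₂]
  have core := fun K : Subfield F => SpFour.good_core (K := K) hirr (SpFour.adj_of_mem hg₁ h₁)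
    (SpFour.adj_of_mem hg₂ h₂) h₁ h₂ h₁' h₂'
  rw [hinv]
  apply le_antisymm
  · rw [Subfield.closure_le]
    rintro _ ⟨m, hm, rfl⟩
    exact (core _ (Subfield.subset_closure (by simp)) (Subfield.subset_closure (by simp))
      (Or.inl (Subfield.subset_closure (by simp)))).2 m hm
  · have m1 : g₁ ∈ Submonoid.closure ({g₁, g₂} : Set (Matrix (Fin 2 ⊕ Fin 2) (Fin 2 ⊕ Fin 2) F)) :=
      Submonoid.subset_closure (by simp)
    have m2 : g₂ ∈ Submonoid.closure ({g₁, g₂} : Set (Matrix (Fin 2 ⊕ Fin 2) (Fin 2 ⊕ Fin 2) F)) :=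
      Submonoid.subset_closure (by simp)
    have t1 : Matrix.trace (g₁ * g₂) ∈ Subfield.closure
        {x : F | ∃ m ∈ Submonoid.closure ({g₁, g₂} :
          Set (Matrix (Fin 2 ⊕ Fin 2) (Fin 2 ⊕ Fin 2) F)), x = Matrix.trace m} :=
      Subfield.subset_closure ⟨_, mul_mem m1 m2, rfl⟩
    have t2 : Matrix.trace (g₁ * g₂ ^ 2) ∈ Subfield.closure
        {x : F | ∃ m ∈ Submonoid.closure ({g₁, g₂} :
          Set (Matrix (Fin 2 ⊕ Fin 2) (Fin 2 ⊕ Fin 2) F)), x = Matrix.trace m} :=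
      Subfield.subset_closure ⟨_, mul_mem m1 (pow_mem m2 2), rfl⟩
    have t3 := (core _ t1 t2 (Or.inr (Subfield.subset_closure
      ⟨_, mul_mem (mul_mem m1 m2) (mul_mem (pow_mem m1 2) (pow_mem m2 2)), rfl⟩))).1
    rw [Subfield.closure_le]
    rintro z hz
    simp only [Set.mem_insert_iff, Set.mem_singleton_iff] at hz
    rcases hz with rfl | rfl | rfl
    · exact t1
    · exact t3
    · exact t2
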